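/- arXiv:1802.08883 — 10 statements merged into one kernel-verified Lean document; each statement's English description precedes it below -/
import Mathlib

section
/- The projection L of the level set D = {x ∈ [0,1]^n : F(x) = 1/2} onto the first n−1 coordinates is Jordan measurable — i.e. the (n−1)-dimensional Lebesgue measure of the topological frontier of L is zero — and L has positive (n−1)-dimensional Lebesgue measure. -/
open MeasureTheory

/-- The integral of `f` over the box spanned by `0` and `x`. -/
noncomputable def boxIntegral {n : ℕ} (f : (Fin n → ℝ) → ℝ) (x : Fin n → ℝ) : ℝ :=
  ∫ t in Set.univ.pi (fun i => Set.Icc 0 (x i)), f t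

lemma integrableOn_unitCube {n : ℕ} {f : (Fin n → ℝ) → ℝ} {M : ℝ} (hf : Measurable f)
    (hb : ∀ x ∈ Set.Icc (0 : Fin n → ℝ) 1, 0 < f x ∧ f x ≤ M) :
    IntegrableOn f (Set.Icc 0 1) := by
  refine Measure.integrableOn_of_bounded (M := M) ?_ hf.aestronglyMeasurable ?_
  · exact isCompact_Icc.measure_lt_top.ne
  · filter_upwards [ae_restrict_mem measurableSet_Icc] with x hx
    rw [Real.norm_eq_abs, abs_of_pos (hb x hx).1]
    exact (hb x hx).2

lemma boxIntegral_mono_and_sub_le {n : ℕ} {f : (Fin n → ℝ) → ℝ} {M : ℝ} (hf : Measurable f)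
    (hb : ∀ x ∈ Set.Icc (0 : Fin n → ℝ) 1, 0 < f x ∧ f x ≤ M)
    {x y : Fin n → ℝ} (hx : 0 ≤ x) (hxy : x ≤ y) (hy : y ≤ 1) :
    boxIntegral f x ≤ boxIntegral f y ∧
      boxIntegral f y - boxIntegral f x ≤ M * (∏ i, y i - ∏ i, x i) := by
  have hbox : ∀ z : Fin n → ℝ, Set.univ.pi (fun i => Set.Icc 0 (z i)) = Set.Icc 0 z :=
    fun z => Set.pi_univ_Icc 0 z
  have hint := integrableOn_unitCube hf hb
  have hsub : Set.Icc 0 x ⊆ Set.Icc 0 y := Set.Icc_subset_Icc_right hxy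
  have hsuby : Set.Icc 0 y ⊆ Set.Icc (0 : Fin n → ℝ) 1 := Set.Icc_subset_Icc_right hy
  have hdiff : MeasurableSet (Set.Icc 0 y \ Set.Icc 0 x) :=
    measurableSet_Icc.diff measurableSet_Icc
  have hfin : volume (Set.Icc 0 y) ≠ ⊤ := isCompact_Icc.measure_lt_top.ne
  have hfin' : volume (Set.Icc 0 y \ Set.Icc 0 x) ≠ ⊤ :=
    ((measure_mono Set.sdiff_subset).trans_lt hfin.lt_top).ne
  have hvol : volume.real (Set.Icc 0 y \ Set.Icc 0 x) = ∏ i, y i - ∏ i, x i := by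
    rw [measureReal_sdiff hsub measurableSet_Icc hfin]
    simp only [Measure.real]
    rw [Real.volume_Icc_pi_toReal hx, Real.volume_Icc_pi_toReal (hx.trans hxy)]
    simp
  have hI : boxIntegral f y - boxIntegral f x = ∫ t in Set.Icc 0 y \ Set.Icc 0 x, f t := by
    simp only [boxIntegral, hbox]
    rw [setIntegral_sdiff measurableSet_Icc (hint.mono_set hsuby) hsub]
  constructor
  · rw [← sub_nonneg, hI]
    exact setIntegral_nonneg hdiff fun t ht => (hb t (hsuby ht.1)).1.le
  · rw [hI, ← hvol]
    have h := setIntegral_mono_on (hint.mono_set (Set.sdiff_subset.trans hsuby))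
      (integrableOn_const hfin' (C := M)) hdiff fun t ht => (hb t (hsuby ht.1)).2
    simpa [mul_comm] using h

lemma snoc_mem_unitCube {m : ℕ} {y : Fin m → ℝ} {t : ℝ} (hy : y ∈ Set.Icc (0 : Fin m → ℝ) 1)
    (ht : t ∈ Set.Icc (0 : ℝ) 1) :
    (Fin.snoc y t : Fin (m + 1) → ℝ) ∈ Set.Icc (0 : Fin (m + 1) → ℝ) 1 := by
  constructor <;> intro i <;> refine Fin.lastCases ?_ (fun j => ?_) i
  · simpa using ht.1
  · simpa using hy.1 j
  · simpa using ht.2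
  · simpa using hy.2 j

lemma snoc_le_snoc_of_le {m : ℕ} {y z : Fin m → ℝ} {s t : ℝ} (hyz : y ≤ z) (hst : s ≤ t) :
    (Fin.snoc y s : Fin (m + 1) → ℝ) ≤ Fin.snoc z t := by
  intro i
  refine Fin.lastCases ?_ (fun j => ?_) i
  · simpa using hst
  · simpa using hyz j

lemma boxIntegral_snoc_zero {m : ℕ} (f : (Fin (m + 1) → ℝ) → ℝ) (y : Fin m → ℝ) :
    boxIntegral f (Fin.snoc y 0) = 0 := by
  refine setIntegral_measure_zero _ ?_
  rw [volume_pi_pi]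
  exact Finset.prod_eq_zero (Finset.mem_univ (Fin.last m)) (by simp)

lemma continuousOn_boxIntegral_snoc {m : ℕ} {f : (Fin (m + 1) → ℝ) → ℝ} {M : ℝ}
    (hM : 0 < M) (hf : Measurable f)
    (hb : ∀ x ∈ Set.Icc (0 : Fin (m + 1) → ℝ) 1, 0 < f x ∧ f x ≤ M)
    {y : Fin m → ℝ} (hy : y ∈ Set.Icc (0 : Fin m → ℝ) 1) :
    ContinuousOn (fun t : ℝ => boxIntegral f (Fin.snoc y t)) (Set.Icc 0 1) := by
  have hprod : ∏ i, y i ≤ 1 := Finset.prod_le_one (fun i _ => hy.1 i) fun i _ => hy.2 i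
  have key : ∀ s ∈ Set.Icc (0 : ℝ) 1, ∀ t ∈ Set.Icc (0 : ℝ) 1, s ≤ t →
      |boxIntegral f (Fin.snoc y t) - boxIntegral f (Fin.snoc y s)| ≤ M * |t - s| := by
    intro s hs t ht hst
    obtain ⟨h1, h2⟩ := boxIntegral_mono_and_sub_le hf hb (snoc_mem_unitCube hy hs).1
      (snoc_le_snoc_of_le le_rfl hst) (snoc_mem_unitCube hy ht).2
    rw [abs_of_nonneg (sub_nonneg.2 h1), abs_of_nonneg (sub_nonneg.2 hst)]
    refine h2.trans (mul_le_mul_of_nonneg_left ?_ hM.le)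
    simp only [Fin.prod_univ_castSucc, Fin.snoc_castSucc, Fin.snoc_last]
    nlinarith
  refine LipschitzOnWith.continuousOn (K := M.toNNReal)
    (LipschitzOnWith.of_dist_le_mul fun s hs t ht => ?_)
  rw [Real.dist_eq, Real.dist_eq, Real.coe_toNNReal M hM.le]
  rcases le_total t s with h | h
  · exact key t ht s hs h
  · rw [abs_sub_comm, abs_sub_comm s]
    exact key s hs t ht h

/-- The projection of a level set consists of the points over which the box integral reaches
the level on the top face. -/
lemma image_levelSet_eq {m : ℕ} {f : (Fin (m + 1) → ℝ) → ℝ} {M : ℝ}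
    (hM : 0 < M) (hf : Measurable f)
    (hb : ∀ x ∈ Set.Icc (0 : Fin (m + 1) → ℝ) 1, 0 < f x ∧ f x ≤ M) {c : ℝ} (hc : 0 ≤ c) :
    (fun (x : Fin (m + 1) → ℝ) (i : Fin m) => x i.castSucc) ''
        {x ∈ Set.Icc (0 : Fin (m + 1) → ℝ) 1 | boxIntegral f x = c} =
      {y ∈ Set.Icc (0 : Fin m → ℝ) 1 | c ≤ boxIntegral f (Fin.snoc y 1)} := by
  ext y
  constructor
  · rintro ⟨x, ⟨hx, rfl⟩, rfl⟩
    have hy : (fun i : Fin m => x i.castSucc) ∈ Set.Icc (0 : Fin m → ℝ) 1 :=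
      ⟨fun i => hx.1 _, fun i => hx.2 _⟩
    refine ⟨hy, (boxIntegral_mono_and_sub_le hf hb hx.1 (fun i => ?_)
      (snoc_mem_unitCube hy ⟨zero_le_one, le_rfl⟩).2).1⟩
    refine Fin.lastCases ?_ (fun j => ?_) i
    · simpa using hx.2 (Fin.last m)
    · simp
  · rintro ⟨hy, hcy⟩
    obtain ⟨t, ht, htc⟩ := intermediate_value_Icc zero_le_one
      (continuousOn_boxIntegral_snoc hM hf hb hy)
      ⟨(boxIntegral_snoc_zero f y).trans_le hc, hcy⟩
    exact ⟨Fin.snoc y t, ⟨snoc_mem_unitCube hy ht, htc⟩, by ext i; simp⟩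

lemma ordConnected_boxIntegral_snoc_ge {m : ℕ} {f : (Fin (m + 1) → ℝ) → ℝ} {M : ℝ}
    (hf : Measurable f)
    (hb : ∀ x ∈ Set.Icc (0 : Fin (m + 1) → ℝ) 1, 0 < f x ∧ f x ≤ M) (c : ℝ) :
    {y ∈ Set.Icc (0 : Fin m → ℝ) 1 | c ≤ boxIntegral f (Fin.snoc y 1)}.OrdConnected := by
  refine ⟨fun x hx z hz y hy => ?_⟩
  have hy' : y ∈ Set.Icc (0 : Fin m → ℝ) 1 := ⟨hx.1.1.trans hy.1, hy.2.trans hz.1.2⟩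
  have h1 : (1 : ℝ) ∈ Set.Icc (0 : ℝ) 1 := ⟨zero_le_one, le_rfl⟩
  exact ⟨hy', hx.2.trans (boxIntegral_mono_and_sub_le hf hb (snoc_mem_unitCube hx.1 h1).1
    (snoc_le_snoc_of_le hy.1 le_rfl) (snoc_mem_unitCube hy' h1).2).1⟩

lemma volume_boxIntegral_snoc_ge_pos {m : ℕ} {f : (Fin (m + 1) → ℝ) → ℝ} {M : ℝ}
    (hM : 0 < M) (hf : Measurable f)
    (hb : ∀ x ∈ Set.Icc (0 : Fin (m + 1) → ℝ) 1, 0 < f x ∧ f x ≤ M) {c : ℝ}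
    (hc : c < boxIntegral f 1) :
    0 < volume {y ∈ Set.Icc (0 : Fin m → ℝ) 1 | c ≤ boxIntegral f (Fin.snoc y 1)} := by
  have hlim : Filter.Tendsto (fun r : ℝ => M * (1 - r ^ m)) (nhdsWithin 1 (Set.Iio 1))
      (nhds 0) := by
    have h : Continuous fun r : ℝ => M * (1 - r ^ m) := by fun_prop
    simpa using (h.tendsto 1).mono_left nhdsWithin_le_nhds
  obtain ⟨r, hr, hr0, hr1⟩ := ((hlim.eventually (gt_mem_nhds (sub_pos.2 hc))).and
    (Ioo_mem_nhdsLT (zero_lt_one (α := ℝ)))).exists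
  have h1 : (1 : ℝ) ∈ Set.Icc (0 : ℝ) 1 := ⟨zero_le_one, le_rfl⟩
  have hsub : Set.Icc (fun _ : Fin m => r) 1 ⊆
      {y ∈ Set.Icc (0 : Fin m → ℝ) 1 | c ≤ boxIntegral f (Fin.snoc y 1)} := by
    intro y hy
    have hy' : y ∈ Set.Icc (0 : Fin m → ℝ) 1 := ⟨fun i => hr0.le.trans (hy.1 i), hy.2⟩
    have hcube := snoc_mem_unitCube hy' h1
    refine ⟨hy', ?_⟩
    have h := (boxIntegral_mono_and_sub_le hf hb hcube.1 hcube.2 le_rfl).2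
    have hprod : r ^ m ≤ ∏ i, y i := by
      simpa using Finset.prod_le_prod (s := Finset.univ) (fun _ _ => hr0.le) fun i _ => hy.1 i
    simp only [Fin.prod_univ_castSucc, Fin.snoc_castSucc, Fin.snoc_last, Pi.one_apply,
      Finset.prod_const_one, mul_one] at h
    nlinarith
  refine lt_of_lt_of_le ?_ (measure_mono hsub)
  rw [Real.volume_Icc_pi, pos_iff_ne_zero, Finset.prod_ne_zero_iff]
  intro i _
  simpa using hr1

/-- The projection `L` of the level set `D = {x ∈ [0,1]^n : F x = 1/2}`
onto the first `n-1` coordinates is Jordan measurable (the Lebesgue measure of its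
topological frontier is zero) and has positive `(n-1)`-dimensional Lebesgue measure. -/
theorem stmt_0 (n : ℕ) (hn : 2 ≤ n)
    (f : (Fin n → ℝ) → ℝ) (M : ℝ) (hM : 0 < M)
    (hf_meas : Measurable f)
    (hf_bound : ∀ x ∈ Set.Icc (0 : Fin n → ℝ) 1, 0 < f x ∧ f x ≤ M)
    (F : (Fin n → ℝ) → ℝ)
    (hF : ∀ x, F x = ∫ t in Set.univ.pi (fun i => Set.Icc 0 (x i)), f t)
    (hF1 : F 1 = 1)
    (D : Set (Fin n → ℝ))
    (hD : D = {x ∈ Set.Icc (0 : Fin n → ℝ) 1 | F x = 1 / 2})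
    (L : Set (Fin (n - 1) → ℝ))
    (hL : L = (fun x : Fin n → ℝ => fun i : Fin (n - 1) =>
      x (Fin.castLE (Nat.sub_le n 1) i)) '' D) :
    volume (frontier L) = 0 ∧ 0 < volume L := by
  obtain ⟨m, rfl⟩ : ∃ m, n = m + 1 := ⟨n - 1, by omega⟩
  obtain rfl : F = boxIntegral f := funext hF
  have hLeq : L = {y ∈ Set.Icc (0 : Fin m → ℝ) 1 | 1 / 2 ≤ boxIntegral f (Fin.snoc y 1)} := by
    rw [hL, hD]
    exact image_levelSet_eq hM hf_meas hf_bound (by norm_num)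
  rw [hLeq]
  exact ⟨(ordConnected_boxIntegral_snoc_ge hf_meas hf_bound _).null_frontier,
    volume_boxIntegral_snoc_ge_pos hM hf_meas hf_bound (by rw [hF1]; norm_num)⟩
end

section
/- For every x' ∈ (0,1)^{n−1} the map t ↦ F(x', t) is strictly increasing on [0,1]. Consequently, for each x' ∈ L ∩ (0,1)^{n−1} there is a unique value h(x') ∈ (0,1] with F(x', h(x')) = 1/2; the resulting function h is continuous on L ∩ (0,1)^{n−1}; and h is strictly decreasing with respect to all variables: if x', y' ∈ L ∩ (0,1)^{n−1} satisfy x'_i ≤ y'_i for every i and x' ≠ y', then h(y') < h(x'). -/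
open MeasureTheory

section BoxIntegral

variable {ι : Type*} [Fintype ι] {f : (ι → ℝ) → ℝ} {M : ℝ}

/-- A bounded positive measurable function is integrable on the unit cube. -/
lemma integrableOn_unitCube_s1 (hf_meas : Measurable f)
    (hf_bound : ∀ x ∈ Set.Icc (0 : ι → ℝ) 1, 0 < f x ∧ f x ≤ M) :
    IntegrableOn f (Set.Icc (0 : ι → ℝ) 1) := by
  refine Measure.integrableOn_of_bounded (M := M) isCompact_Icc.measure_lt_top.ne
    hf_meas.aestronglyMeasurable ?_
  filter_upwards [ae_restrict_mem measurableSet_Icc] with x hx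
  rw [Real.norm_eq_abs, abs_of_pos (hf_bound x hx).1]
  exact (hf_bound x hx).2

/-- The integral of a positive function over the boxes `[0, x]` is strictly increasing in `x`,
up to a nondegenerate box. -/
lemma setIntegral_Icc_lt_setIntegral_Icc
    (hf : IntegrableOn f (Set.Icc (0 : ι → ℝ) 1))
    (hf_pos : ∀ x ∈ Set.Icc (0 : ι → ℝ) 1, 0 < f x)
    {x y : ι → ℝ} (hx : 0 ≤ x) (hxy : x < y) (hy : ∀ i, 0 < y i) (hy1 : y ≤ 1) :
    ∫ t in Set.Icc 0 x, f t < ∫ t in Set.Icc 0 y, f t := by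
  have hsub : Set.Icc 0 y ⊆ Set.Icc (0 : ι → ℝ) 1 := Set.Icc_subset_Icc_right hy1
  have hfy := hf.mono_set hsub
  rw [← sub_pos, ← setIntegral_sdiff measurableSet_Icc hfy (Set.Icc_subset_Icc_right hxy.le)]
  have hmeas : MeasurableSet (Set.Icc 0 y \ Set.Icc 0 x) :=
    measurableSet_Icc.diff measurableSet_Icc
  rw [setIntegral_pos_iff_support_of_nonneg_ae _ (hfy.mono_set Set.sdiff_subset)]
  · obtain ⟨i, hi⟩ := (Pi.lt_def.1 hxy).2
    classical
    let a : ι → ℝ := Function.update 0 i (x i)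
    have ha : ∀ j, 0 ≤ a j ∧ a j < y j := by
      intro j
      rcases eq_or_ne j i with rfl | hj
      · simpa [a] using ⟨hx j, hi⟩
      · simpa [a, hj] using hy j
    have hopen : IsOpen (Set.univ.pi fun j => Set.Ioo (a j) (y j)) :=
      isOpen_set_pi Set.finite_univ fun j _ => isOpen_Ioo
    have hne : (Set.univ.pi fun j => Set.Ioo (a j) (y j)).Nonempty :=
      Set.univ_pi_nonempty_iff.2 fun j => Set.nonempty_Ioo.2 (ha j).2
    refine (hopen.measure_pos volume hne).trans_le (measure_mono fun t ht => ?_)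
    have ht' : ∀ j, a j < t j ∧ t j < y j := fun j => ht j trivial
    have hty : t ∈ Set.Icc 0 y :=
      ⟨fun j => (ha j).1.trans (ht' j).1.le, fun j => (ht' j).2.le⟩
    refine ⟨(hf_pos t (hsub hty)).ne', hty, fun htx => ?_⟩
    have := (ht' i).1
    simp only [a, Function.update_self] at this
    exact this.not_ge (htx.2 i)
  · filter_upwards [ae_restrict_mem hmeas] with t ht
    exact (hf_pos t (hsub ht.1)).le

/-- The integral of an integrable function over the box `[0, x]` is continuous in `x`. -/
lemma continuousOn_setIntegral_Icc (hf : IntegrableOn f (Set.Icc (0 : ι → ℝ) 1)) :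
    ContinuousOn (fun x => ∫ t in Set.Icc 0 x, f t) (Set.Icc (0 : ι → ℝ) 1) := by
  have heq : ∀ x ∈ Set.Icc (0 : ι → ℝ) 1, ∫ t in Set.Icc 0 x, f t =
      ∫ t in Set.Icc (0 : ι → ℝ) 1, (Set.Icc 0 x).indicator f t := by
    intro x hx
    rw [setIntegral_indicator measurableSet_Icc,
      Set.inter_eq_right.2 (Set.Icc_subset_Icc_right hx.2)]
  refine ContinuousOn.congr (fun x _ => ?_) heq
  refine continuousWithinAt_of_dominated (bound := fun t => ‖f t‖) ?_ ?_ hf.norm ?_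
  · exact Filter.Eventually.of_forall fun y =>
      hf.aestronglyMeasurable.indicator measurableSet_Icc
  · exact Filter.Eventually.of_forall fun y =>
      Filter.Eventually.of_forall fun t => norm_indicator_le_norm_self _ _
  · have hae : ∀ᵐ t : ι → ℝ, ∀ i, t i ≠ x i :=
      ae_all_iff.2 fun i => Measure.ae_eval_ne (fun _ : ι => (volume : Measure ℝ)) i (x i)
    filter_upwards [ae_restrict_of_ae hae, ae_restrict_mem measurableSet_Icc] with t ht ht0
    refine ContinuousAt.continuousWithinAt (tendsto_nhds_of_eventually_eq ?_)
    have hev : ∀ᶠ y : ι → ℝ in nhds x, ∀ i, (t i ≤ y i ↔ t i ≤ x i) := by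
      refine Filter.eventually_all.2 fun i => ?_
      have hc : Filter.Tendsto (fun y : ι → ℝ => y i) (nhds x) (nhds (x i)) :=
        (continuous_apply i).tendsto x
      rcases lt_or_gt_of_ne (ht i) with h | h
      · filter_upwards [hc.eventually_const_lt h] with y hy using iff_of_true hy.le h.le
      · filter_upwards [hc.eventually_lt_const h] with y hy using
          iff_of_false hy.not_ge h.not_ge
    filter_upwards [hev] with y hy
    have hmem : t ∈ Set.Icc 0 y ↔ t ∈ Set.Icc 0 x := by
      simp only [Set.mem_Icc, Pi.le_def (x := t), hy]
    by_cases htx : t ∈ Set.Icc 0 x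
    · rw [Set.indicator_of_mem htx, Set.indicator_of_mem (hmem.2 htx)]
    · rw [Set.indicator_of_notMem htx, Set.indicator_of_notMem (mt hmem.1 htx)]

end BoxIntegral

/-- For every `x' ∈ (0,1)^{n-1}` the map `t ↦ F(x', t)` is strictly
increasing on `[0,1]`; consequently there is a function `h` such that for every
`x' ∈ L ∩ (0,1)^{n-1}`, `h x'` is the unique value in `(0,1]` with `F(x', h x') = 1/2`,
`h` is continuous on `L ∩ (0,1)^{n-1}`, and `h` is strictly decreasing with respect
to all variables. -/
theorem stmt_1 (n : ℕ) (hn : 2 ≤ n)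
    (f : (Fin n → ℝ) → ℝ) (M : ℝ) (hM : 0 < M)
    (hf_meas : Measurable f)
    (hf_bound : ∀ x ∈ Set.Icc (0 : Fin n → ℝ) 1, 0 < f x ∧ f x ≤ M)
    (F : (Fin n → ℝ) → ℝ)
    (hF : ∀ x, F x = ∫ t in Set.univ.pi (fun i => Set.Icc 0 (x i)), f t)
    (hF1 : F 1 = 1)
    (D : Set (Fin n → ℝ))
    (hD : D = {x ∈ Set.Icc (0 : Fin n → ℝ) 1 | F x = 1 / 2})
    (L : Set (Fin (n - 1) → ℝ))
    (hL : L = (fun x : Fin n → ℝ => fun i : Fin (n - 1) =>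
      x (Fin.castLE (Nat.sub_le n 1) i)) '' D)
    (ext : (Fin (n - 1) → ℝ) → ℝ → (Fin n → ℝ))
    (hext : ∀ x' t i, ext x' t i = if h : (i : ℕ) < n - 1 then x' ⟨i, h⟩ else t) :
    (∀ x' ∈ Set.univ.pi (fun _ : Fin (n - 1) => Set.Ioo (0 : ℝ) 1),
        StrictMonoOn (fun t => F (ext x' t)) (Set.Icc 0 1)) ∧
    ∃ h : (Fin (n - 1) → ℝ) → ℝ,
      (∀ x' ∈ L ∩ Set.univ.pi (fun _ : Fin (n - 1) => Set.Ioo (0 : ℝ) 1),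
          h x' ∈ Set.Ioc (0 : ℝ) 1 ∧ F (ext x' (h x')) = 1 / 2 ∧
          ∀ t ∈ Set.Ioc (0 : ℝ) 1, F (ext x' t) = 1 / 2 → t = h x') ∧
      ContinuousOn h (L ∩ Set.univ.pi (fun _ : Fin (n - 1) => Set.Ioo (0 : ℝ) 1)) ∧
      (∀ x' ∈ L ∩ Set.univ.pi (fun _ : Fin (n - 1) => Set.Ioo (0 : ℝ) 1),
        ∀ y' ∈ L ∩ Set.univ.pi (fun _ : Fin (n - 1) => Set.Ioo (0 : ℝ) 1),
          (∀ i, x' i ≤ y' i) → x' ≠ y' → h y' < h x') := by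
  set C : Set (Fin (n - 1) → ℝ) := Set.univ.pi fun _ => Set.Ioo (0 : ℝ) 1
  obtain rfl : F = fun x => ∫ t in Set.Icc 0 x, f t := by
    funext x
    rw [hF, ← Set.pi_univ_Icc]
    rfl
  have hint := integrableOn_unitCube_s1 hf_meas hf_bound
  have hlt {x y : Fin n → ℝ} (hx : 0 ≤ x) (hxy : x < y) (hy : ∀ i, 0 < y i) (hy1 : y ≤ 1) :=
    setIntegral_Icc_lt_setIntegral_Icc hint (fun x hx => (hf_bound x hx).1) hx hxy hy hy1
  have hcont := continuousOn_setIntegral_Icc hint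
  set F : (Fin n → ℝ) → ℝ := fun x => ∫ t in Set.Icc 0 x, f t
  let last : Fin n := ⟨n - 1, by omega⟩
  have hext_last (x' : Fin (n - 1) → ℝ) (t : ℝ) : ext x' t last = t := by simp [hext, last]
  have hext_cast (x' : Fin (n - 1) → ℝ) (t : ℝ) (i : Fin (n - 1)) :
      ext x' t (Fin.castLE (Nat.sub_le n 1) i) = x' i := by simp [hext]
  have hext_mem {x' : Fin (n - 1) → ℝ} (hx : x' ∈ C) {t : ℝ} (ht : t ∈ Set.Icc (0 : ℝ) 1) :
      ext x' t ∈ Set.Icc (0 : Fin n → ℝ) 1 := by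
    constructor <;> intro i <;> rw [hext] <;> split_ifs with hi
    exacts [(hx _ trivial).1.le, ht.1, (hx _ trivial).2.le, ht.2]
  have hext_pos {x' : Fin (n - 1) → ℝ} (hx : x' ∈ C) {t : ℝ} (ht : 0 < t) (i : Fin n) :
      0 < ext x' t i := by
    rw [hext]
    split_ifs with hi
    exacts [(hx _ trivial).1, ht]
  have hext_mono {x' y' : Fin (n - 1) → ℝ} (hxy : ∀ i, x' i ≤ y' i) {s t : ℝ} (hst : s ≤ t) :
      ext x' s ≤ ext y' t := by
    intro i
    rw [hext, hext]
    split_ifs with hi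
    exacts [hxy _, hst]
  have hmono (x') (hx : x' ∈ C) : StrictMonoOn (fun t => F (ext x' t)) (Set.Icc 0 1) := by
    intro s hs t ht hst
    refine hlt (hext_mem hx hs).1 (lt_of_le_of_ne (hext_mono (fun _ => le_rfl) hst.le) ?_)
      (hext_pos hx (hs.1.trans_lt hst)) (hext_mem hx ht).2
    intro h
    have := congrFun h last
    rw [hext_last, hext_last] at this
    exact hst.ne this
  refine ⟨hmono, ?_⟩
  have hex : ∀ x', ∃ t : ℝ, x' ∈ L ∩ C → t ∈ Set.Ioc (0 : ℝ) 1 ∧ F (ext x' t) = 1 / 2 := by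
    intro x'
    by_cases hx : x' ∈ L ∩ C
    swap
    · exact ⟨0, fun h => absurd h hx⟩
    obtain ⟨hxL, -⟩ := hx
    rw [hL, hD] at hxL
    obtain ⟨x, ⟨hx1, hFx⟩, rfl⟩ := hxL
    refine ⟨x last, fun _ => ?_⟩
    have hx_eq : ext (fun i => x (Fin.castLE (Nat.sub_le n 1) i)) (x last) = x := by
      funext i
      rw [hext]
      split_ifs with hi
      · rfl
      · exact congrArg x (Fin.ext (by simp only [last]; omega))
    refine ⟨⟨lt_of_le_of_ne (hx1.1 last) fun h0 => ?_, hx1.2 last⟩, hx_eq.symm ▸ hFx⟩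
    have hnull : volume (Set.Icc 0 x) = 0 := by
      rw [Real.volume_Icc_pi]
      exact Finset.prod_eq_zero (Finset.mem_univ last) (by simp [← h0])
    have hzero : F x = 0 := setIntegral_measure_zero f hnull
    rw [hzero] at hFx
    norm_num at hFx
  choose h hh using hex
  refine ⟨h, fun x' hx => ⟨(hh x' hx).1, (hh x' hx).2, fun t ht hFt => ?_⟩, fun x' hx => ?_,
    fun x' hx y' hy hxy hne => ?_⟩
  · exact (hmono x' hx.2).injOn (Set.Ioc_subset_Icc_self ht)
      (Set.Ioc_subset_Icc_self (hh x' hx).1) (hFt.trans (hh x' hx).2.symm)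
  · have hslice {t : ℝ} (ht : t ∈ Set.Icc (0 : ℝ) 1) :
        ContinuousWithinAt (fun y' => F (ext y' t)) (L ∩ C) x' := by
      refine (hcont _ (hext_mem hx.2 ht)).comp (f := fun y' => ext y' t)
        (Continuous.continuousWithinAt ?_) fun y' hy => hext_mem hy.2 ht
      refine continuous_pi fun i => ?_
      simp only [hext]
      split_ifs with hi <;> fun_prop
    have hhx := hh x' hx
    have hhx' := Set.Ioc_subset_Icc_self hhx.1
    refine tendsto_order.2 ⟨fun a ha => ?_, fun b hb => ?_⟩
    · rcases lt_or_ge a 0 with ha0 | ha0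
      · filter_upwards [self_mem_nhdsWithin] with y' hy using ha0.trans (hh y' hy).1.1
      · have haI : a ∈ Set.Icc (0 : ℝ) 1 := ⟨ha0, ha.le.trans hhx'.2⟩
        have hFa : F (ext x' a) < 1 / 2 := hhx.2 ▸ hmono x' hx.2 haI hhx' ha
        filter_upwards [self_mem_nhdsWithin, (hslice haI).eventually_lt_const hFa] with y' hy hFy
        rw [← (hh y' hy).2] at hFy
        exact ((hmono y' hy.2).lt_iff_lt haI (Set.Ioc_subset_Icc_self (hh y' hy).1)).1 hFy
    · rcases lt_or_ge 1 b with hb1 | hb1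
      · filter_upwards [self_mem_nhdsWithin] with y' hy using (hh y' hy).1.2.trans_lt hb1
      · have hbI : b ∈ Set.Icc (0 : ℝ) 1 := ⟨hhx'.1.trans hb.le, hb1⟩
        have hFb : 1 / 2 < F (ext x' b) := hhx.2 ▸ hmono x' hx.2 hhx' hbI hb
        filter_upwards [self_mem_nhdsWithin, (hslice hbI).eventually_const_lt hFb] with y' hy hFy
        rw [← (hh y' hy).2] at hFy
        exact ((hmono y' hy.2).lt_iff_lt (Set.Ioc_subset_Icc_self (hh y' hy).1) hbI).1 hFy
  · by_contra! hle
    have hhx := hh x' hx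
    have hhy := hh y' hy
    refine (hlt (hext_mem hx.2 (Set.Ioc_subset_Icc_self hhx.1)).1
      (lt_of_le_of_ne (hext_mono hxy hle) fun heq => hne ?_) (hext_pos hy.2 hhy.1.1)
      (hext_mem hy.2 (Set.Ioc_subset_Icc_self hhy.1)).2).ne (hhx.2.trans hhy.2.symm)
    funext i
    simpa only [hext_cast] using congrFun heq (Fin.castLE (Nat.sub_le n 1) i)
end

section
/- There exist t ∈ (0,1) and δ > 0 such that F(t, t, …, t) = 1/2 and every point x' ∈ [0,1]^{n−1} with ∑_{i=1}^{n−1} |x'_i − t| < δ belongs to L; in particular the point (t, …, t) ∈ ℝ^{n−1} is an interior point of L, so L has nonempty interior. -/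
open MeasureTheory

/-- The distribution function of an integrable function is continuous. -/
theorem continuous_setIntegral_Iic {ι : Type*} [Fintype ι] {g : (ι → ℝ) → ℝ}
    (hg : Integrable g) : Continuous fun x => ∫ t in Set.Iic x, g t := by
  simp_rw [← integral_indicator measurableSet_Iic]
  rw [continuous_iff_continuousAt]
  intro x
  refine continuousAt_of_dominated (bound := fun t => ‖g t‖) ?_ ?_ hg.norm ?_
  · exact .of_forall fun y => (hg.indicator measurableSet_Iic).aestronglyMeasurable
  · exact .of_forall fun y => .of_forall fun t => norm_indicator_le_norm_self _ _
  · have hne : ∀ᵐ t : ι → ℝ, ∀ i, t i ≠ x i :=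
      ae_all_iff.2 fun i => Measure.ae_eval_ne (μ := fun _ : ι => (volume : Measure ℝ)) i (x i)
    filter_upwards [hne] with t ht
    refine tendsto_nhds_of_eventually_eq ?_
    have hside : ∀ᶠ y in nhds x, ∀ i, (t i ≤ y i ↔ t i ≤ x i) := by
      refine Filter.eventually_all.2 fun i => ?_
      have hi : Filter.Tendsto (fun y : ι → ℝ => y i) (nhds x) (nhds (x i)) :=
        (continuous_apply i).tendsto x
      rcases lt_or_gt_of_ne (ht i) with h | h
      · filter_upwards [hi.eventually_const_lt h] with y hy
        exact ⟨fun _ => h.le, fun _ => hy.le⟩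
      · filter_upwards [hi.eventually_lt_const h] with y hy
        exact ⟨fun h' => absurd h' hy.not_ge, fun h' => absurd h' h.not_ge⟩
    filter_upwards [hside] with y hy
    have hmem : t ∈ Set.Iic y ↔ t ∈ Set.Iic x := forall_congr' hy
    by_cases htx : t ∈ Set.Iic x
    · rw [Set.indicator_of_mem htx, Set.indicator_of_mem (hmem.2 htx)]
    · rw [Set.indicator_of_notMem htx, Set.indicator_of_notMem (mt hmem.1 htx)]

/-- Restricting an integral over a box anchored at the origin to the unit cube. -/
theorem setIntegral_pi_Icc_zero_eq_setIntegral_Iic {ι : Type*} [Fintype ι]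
    (f : (ι → ℝ) → ℝ) {x : ι → ℝ} (hx : x ≤ 1) :
    ∫ t in Set.univ.pi (fun i => Set.Icc 0 (x i)), f t =
      ∫ t in Set.Iic x, (Set.Icc (0 : ι → ℝ) 1).indicator f t := by
  have hset : Set.univ.pi (fun i => Set.Icc 0 (x i)) = Set.Iic x ∩ Set.Icc 0 1 := by
    rw [Set.pi_univ_Icc]
    ext t
    exact ⟨fun h => ⟨h.2, h.1, h.2.trans hx⟩, fun h => ⟨h.2.1, h.1⟩⟩
  rw [hset, setIntegral_indicator measurableSet_Icc]

/-- Increasing one coordinate strictly increases the integral of a function which is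
positive on the unit cube. -/
theorem setIntegral_Iic_lt_of_lt_apply {ι : Type*} [Fintype ι] {f : (ι → ℝ) → ℝ}
    (hpos : ∀ x ∈ Set.Icc (0 : ι → ℝ) 1, 0 < f x)
    (hint : Integrable ((Set.Icc (0 : ι → ℝ) 1).indicator f)) {x y : ι → ℝ}
    (hx : ∀ i, 0 < x i) (hxy : x ≤ y) (hy : y ≤ 1) {j : ι} (hj : x j < y j) :
    ∫ t in Set.Iic x, (Set.Icc (0 : ι → ℝ) 1).indicator f t <
      ∫ t in Set.Iic y, (Set.Icc (0 : ι → ℝ) 1).indicator f t := by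
  classical
  set g := (Set.Icc (0 : ι → ℝ) 1).indicator f
  have hg0 : 0 ≤ g := Set.indicator_nonneg fun z hz => (hpos z hz).le
  rw [← sub_pos, ← setIntegral_sdiff measurableSet_Iic hint.integrableOn (Set.Iic_subset_Iic.2 hxy),
    setIntegral_pos_iff_support_of_nonneg_ae (.of_forall hg0) hint.integrableOn]
  set a : ι → ℝ := Function.update 0 j (x j)
  have ha0 : 0 ≤ a := by
    intro i
    rcases eq_or_ne i j with rfl | h
    · simpa [a] using (hx i).le
    · simp [a, h]
  have hay : ∀ i, a i < y i := by
    intro i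
    rcases eq_or_ne i j with rfl | h
    · simpa [a] using hj
    · simpa [a, h] using (hx i).trans_le (hxy i)
  have hopen : IsOpen (Set.univ.pi fun i => Set.Ioo (a i) (y i)) :=
    isOpen_set_pi Set.finite_univ fun i _ => isOpen_Ioo
  refine (hopen.measure_pos volume
    (Set.univ_pi_nonempty_iff.2 fun i => Set.nonempty_Ioo.2 (hay i))).trans_le (measure_mono ?_)
  intro z hz
  have hz' : ∀ i, a i < z i ∧ z i < y i := fun i => hz i (Set.mem_univ i)
  have hzI : z ∈ Set.Icc (0 : ι → ℝ) 1 :=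
    ⟨fun i => (ha0 i).trans (hz' i).1.le, fun i => (hz' i).2.le.trans (hy i)⟩
  refine ⟨?_, fun i => (hz' i).2.le, fun h => ?_⟩
  · exact (Set.indicator_of_mem hzI f).trans_ne (hpos z hzI).ne'
  · have := (hz' j).1
    simp only [a, Function.update_self] at this
    exact this.not_ge (h j)

/-- If some coordinate of `x` vanishes, the integral over `Iic x` of a function supported in the
unit cube vanishes. -/
theorem setIntegral_Iic_indicator_eq_zero {ι : Type*} [Fintype ι] (f : (ι → ℝ) → ℝ)
    {x : ι → ℝ} {j : ι} (hj : x j = 0) :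
    ∫ t in Set.Iic x, (Set.Icc (0 : ι → ℝ) 1).indicator f t = 0 := by
  have hne : ∀ᵐ t : ι → ℝ, t j ≠ 0 :=
    Measure.ae_eval_ne (μ := fun _ : ι => (volume : Measure ℝ)) j 0
  refine setIntegral_eq_zero_of_ae_eq_zero ?_
  filter_upwards [hne] with t ht htx
  refine Set.indicator_of_notMem (fun h => ht ?_) _
  exact le_antisymm ((htx j).trans hj.le) (h.1 j)

/-- Append the value `c` to a point of `ℝ^{n-1}`. -/
def appendLast {n : ℕ} (x : Fin (n - 1) → ℝ) (c : ℝ) : Fin n → ℝ :=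
  fun i => if h : i.val < n - 1 then x ⟨i, h⟩ else c

theorem continuous_appendLast {n : ℕ} :
    Continuous fun p : (Fin (n - 1) → ℝ) × ℝ => (appendLast p.1 p.2 : Fin n → ℝ) := by
  refine continuous_pi fun i => ?_
  unfold appendLast
  split_ifs <;> fun_prop

theorem appendLast_mem_Icc {n : ℕ} {x : Fin (n - 1) → ℝ} (hx : x ∈ Set.Icc 0 1) {c : ℝ}
    (hc : c ∈ Set.Icc (0 : ℝ) 1) : (appendLast x c : Fin n → ℝ) ∈ Set.Icc 0 1 := by
  constructor <;> intro i <;> unfold appendLast <;> split_ifs with h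
  exacts [hx.1 _, hc.1, hx.2 _, hc.2]

theorem appendLast_castLE {n : ℕ} (x : Fin (n - 1) → ℝ) (c : ℝ) (i : Fin (n - 1)) :
    (appendLast x c : Fin n → ℝ) (Fin.castLE (Nat.sub_le n 1) i) = x i := by
  simp [appendLast]

/-- There exist `t ∈ (0,1)` and `δ > 0` such that `F(t,…,t) = 1/2` and
every `x' ∈ [0,1]^{n-1}` with `∑ |x'_i - t| < δ` belongs to `L`; in particular
`(t,…,t)` is an interior point of `L`, so `L` has nonempty interior. -/
theorem stmt_2 (n : ℕ) (hn : 2 ≤ n)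
    (f : (Fin n → ℝ) → ℝ) (M : ℝ) (hM : 0 < M)
    (hf_meas : Measurable f)
    (hf_bound : ∀ x ∈ Set.Icc (0 : Fin n → ℝ) 1, 0 < f x ∧ f x ≤ M)
    (F : (Fin n → ℝ) → ℝ)
    (hF : ∀ x, F x = ∫ t in Set.univ.pi (fun i => Set.Icc 0 (x i)), f t)
    (hF1 : F 1 = 1)
    (D : Set (Fin n → ℝ))
    (hD : D = {x ∈ Set.Icc (0 : Fin n → ℝ) 1 | F x = 1 / 2})
    (L : Set (Fin (n - 1) → ℝ))
    (hL : L = (fun x : Fin n → ℝ => fun i : Fin (n - 1) =>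
      x (Fin.castLE (Nat.sub_le n 1) i)) '' D) :
    ∃ t ∈ Set.Ioo (0 : ℝ) 1, ∃ δ > (0 : ℝ),
      F (fun _ => t) = 1 / 2 ∧
      (∀ x' ∈ Set.Icc (0 : Fin (n - 1) → ℝ) 1, (∑ i, |x' i - t|) < δ → x' ∈ L) ∧
      (fun _ : Fin (n - 1) => t) ∈ interior L ∧
      (interior L).Nonempty := by
  set g := (Set.Icc (0 : Fin n → ℝ) 1).indicator f with hg
  set G : (Fin n → ℝ) → ℝ := fun x => ∫ t in Set.Iic x, g t with hG
  have hFG : ∀ x ∈ Set.Icc (0 : Fin n → ℝ) 1, F x = G x := fun x hx => by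
    rw [hF, setIntegral_pi_Icc_zero_eq_setIntegral_Iic f hx.2]
  have hint : Integrable g := by
    rw [hg, integrable_indicator_iff measurableSet_Icc]
    refine Measure.integrableOn_of_bounded (M := M) isCompact_Icc.measure_lt_top.ne
      hf_meas.aestronglyMeasurable ?_
    filter_upwards [ae_restrict_mem measurableSet_Icc] with x hx
    rw [Real.norm_of_nonneg (hf_bound x hx).1.le]
    exact (hf_bound x hx).2
  have hcont : Continuous G := continuous_setIntegral_Iic hint
  have hconst : ∀ {m : ℕ} {s : ℝ}, s ∈ Set.Icc (0 : ℝ) 1 →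
      (fun _ => s) ∈ Set.Icc (0 : Fin m → ℝ) 1 := fun h => ⟨fun _ => h.1, fun _ => h.2⟩
  let last : Fin n := ⟨n - 1, by omega⟩
  have hlast : ∀ (x : Fin (n - 1) → ℝ) (c : ℝ), (appendLast x c : Fin n → ℝ) last = c := by
    intro x c
    simp [appendLast, last]
  have hG1 : G (fun _ => 1) = 1 := by
    rw [← hFG _ (hconst (by simp))]
    exact hF1
  have hG0 : G (fun _ => 0) = 0 := setIntegral_Iic_indicator_eq_zero f (j := last) rfl
  obtain ⟨t, ht, htG⟩ : ∃ t ∈ Set.Icc (0 : ℝ) 1, G (fun _ => t) = 1 / 2 := by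
    have hdiag : Continuous fun s : ℝ => G (fun _ => s) := hcont.comp (by fun_prop)
    refine intermediate_value_Icc zero_le_one hdiag.continuousOn ⟨?_, ?_⟩
    · rw [hG0]; norm_num
    · rw [hG1]; norm_num
  have ht0 : 0 < t := ht.1.lt_of_ne (by rintro rfl; norm_num [hG0] at htG)
  have ht1 : t < 1 := ht.2.lt_of_ne (by rintro rfl; norm_num [hG1] at htG)
  have hgt : 1 / 2 < G (appendLast (fun _ => t) 1) := by
    rw [← htG]
    refine setIntegral_Iic_lt_of_lt_apply (fun x hx => (hf_bound x hx).1) hint (fun _ => ht0)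
      (fun i => ?_) (appendLast_mem_Icc (hconst ht) (by simp)).2 (j := last) ?_
    · unfold appendLast
      split_ifs
      exacts [le_rfl, ht.2]
    · rwa [hlast]
  have htop : Continuous fun x : Fin (n - 1) → ℝ => G (appendLast x 1) :=
    hcont.comp (continuous_appendLast.comp (by fun_prop : Continuous fun x => (x, (1 : ℝ))))
  obtain ⟨δ, hδ, hball⟩ := Metric.eventually_nhds_iff.1
    (htop.continuousAt.eventually_const_lt hgt)
  have hsub : ∀ x' ∈ Set.Icc (0 : Fin (n - 1) → ℝ) 1, (∑ i, |x' i - t|) < δ → x' ∈ L := by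
    intro x' hx' hsum
    have hx1 : 1 / 2 < G (appendLast x' 1) := by
      refine hball ((dist_pi_lt_iff hδ).2 fun i => lt_of_le_of_lt ?_ hsum)
      rw [Real.dist_eq]
      exact Finset.single_le_sum (f := fun i => |x' i - t|) (fun _ _ => abs_nonneg _)
        (Finset.mem_univ i)
    have hx0 : G (appendLast x' 0) = 0 :=
      setIntegral_Iic_indicator_eq_zero f (j := last) (hlast x' 0)
    have hline : Continuous fun c : ℝ => G (appendLast x' c) :=
      hcont.comp (continuous_appendLast.comp (by fun_prop : Continuous fun c => (x', c)))
    obtain ⟨c, hc, hcG⟩ : ∃ c ∈ Set.Icc (0 : ℝ) 1, G (appendLast x' c) = 1 / 2 := by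
      refine intermediate_value_Icc zero_le_one hline.continuousOn ⟨?_, hx1.le⟩
      rw [hx0]; norm_num
    have hmem := appendLast_mem_Icc hx' hc
    rw [hL, hD]
    exact ⟨appendLast x' c, ⟨hmem, (hFG _ hmem).trans hcG⟩, funext (appendLast_castLE x' c)⟩
  have hinterior : (fun _ : Fin (n - 1) => t) ∈ interior L := by
    rw [mem_interior_iff_mem_nhds]
    have hsum : Continuous fun x : Fin (n - 1) → ℝ => ∑ i, |x i - t| := by fun_prop
    have hnear : ∀ᶠ x in nhds (fun _ : Fin (n - 1) => t), ∑ i, |x i - t| < δ :=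
      hsum.continuousAt.eventually_lt_const (by simpa using hδ)
    filter_upwards [pi_Icc_mem_nhds (fun _ => ht0) (fun _ => ht1), hnear] with x hx hxδ
    exact hsub x hx hxδ
  exact ⟨t, ⟨ht0, ht1⟩, δ, hδ, (hFG _ (hconst ht)).trans htG, hsub, hinterior, _, hinterior⟩
end

section
/- For all real numbers x, y ∈ (0,1), min(x, y) − x·y ≤ √(x(1−x) · y(1−y)), and equality holds if and only if x = y. -/
theorem min_sub_mul_lt_sqrt_of_lt {x y : ℝ} (hx : 0 < x) (hy : y < 1) (hxy : x < y) :
    min x y - x * y < Real.sqrt (x * (1 - x) * (y * (1 - y))) := by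
  rw [min_eq_left hxy.le]
  apply Real.lt_sqrt_of_sq_lt
  have h : 0 < x * (1 - y) * (y - x) :=
    mul_pos (mul_pos hx (sub_pos.2 hy)) (sub_pos.2 hxy)
  linarith

theorem min_self_sub_mul_self_eq_sqrt {x : ℝ} (hx : x ∈ Set.Ioo (0 : ℝ) 1) :
    min x x - x * x = Real.sqrt (x * (1 - x) * (x * (1 - x))) := by
  rw [Real.sqrt_mul_self (mul_nonneg hx.1.le (sub_nonneg.2 hx.2.le)), min_self]
  ring

/-- For `x, y ∈ (0,1)`, `min x y - x*y ≤ √(x(1-x) * y(1-y))`,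
with equality iff `x = y`. -/
theorem stmt_5 (x y : ℝ) (hx : x ∈ Set.Ioo (0 : ℝ) 1) (hy : y ∈ Set.Ioo (0 : ℝ) 1) :
    min x y - x * y ≤ Real.sqrt (x * (1 - x) * (y * (1 - y))) ∧
    (min x y - x * y = Real.sqrt (x * (1 - x) * (y * (1 - y))) ↔ x = y) := by
  rcases lt_trichotomy x y with hxy | rfl | hxy
  · have h := min_sub_mul_lt_sqrt_of_lt hx.1 hy.2 hxy
    exact ⟨h.le, iff_of_false h.ne hxy.ne⟩
  · have h := min_self_sub_mul_self_eq_sqrt hx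
    exact ⟨h.le, iff_of_true h rfl⟩
  · have h := min_sub_mul_lt_sqrt_of_lt hy.1 hx.2 hxy
    rw [min_comm, mul_comm y x, mul_comm (y * (1 - y))] at h
    exact ⟨h.le, iff_of_false h.ne hxy.ne'⟩
end

section
/- For every ε with 0 < ε < min_{1≤i≤n} min_{z∈D} a_i(z), there exists δ > 0 such that for all z ∈ D and all x, y ∈ [0,1]^n with ∑_{i=1}^n |x_i − z_i| ≤ δ and ∑_{i=1}^n |y_i − z_i| ≤ δ, one has ∑_{i=1}^n (a_i(z) − ε)|x_i − y_i| ≤ F(x) + F(y) − 2·F(x ∧ y) ≤ ∑_{i=1}^n (a_i(z) + ε)|x_i − y_i|. -/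
/-- Under condition (FEXM), for every `ε` with
`0 < ε < min_i min_{z ∈ D} a_i(z)` there is `δ > 0` such that for all `z ∈ D` and
`x, y ∈ [0,1]^n` within `δ` of `z` (in the `ℓ¹` sense),
`∑ (a_i(z) - ε)|x_i - y_i| ≤ F(x) + F(y) - 2 F(x ∧ y) ≤ ∑ (a_i(z) + ε)|x_i - y_i|`. -/
theorem stmt_7 (n : ℕ) (hn : 2 ≤ n)
    (F : (Fin n → ℝ) → ℝ)
    (hFcont : ContinuousOn F (Set.Icc (0 : Fin n → ℝ) 1))
    (D : Set (Fin n → ℝ))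
    (hD : D = {x ∈ Set.Icc (0 : Fin n → ℝ) 1 | F x = 1 / 2})
    (hDne : D.Nonempty)
    (a : Fin n → (Fin n → ℝ) → ℝ)
    (ha_cont : ∀ i, ContinuousOn (a i) D)
    (ha_pos : ∀ i, ∀ z ∈ D, 0 < a i z)
    (hFEXM : ∀ ε > (0 : ℝ), ∃ δ > (0 : ℝ), ∀ z ∈ D,
      ∀ x ∈ Set.Icc (0 : Fin n → ℝ) 1, ∀ y ∈ Set.Icc (0 : Fin n → ℝ) 1,
        (∑ i, |x i - z i|) ≤ δ → (∑ i, |y i - z i|) ≤ δ →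
        |F x - F y - ∑ i, a i z * (x i - y i)| ≤ ε * ∑ i, |x i - y i|) :
    ∀ ε : ℝ, 0 < ε → (∀ i, ∀ z ∈ D, ε < a i z) →
      ∃ δ > (0 : ℝ), ∀ z ∈ D,
        ∀ x ∈ Set.Icc (0 : Fin n → ℝ) 1, ∀ y ∈ Set.Icc (0 : Fin n → ℝ) 1,
          (∑ i, |x i - z i|) ≤ δ → (∑ i, |y i - z i|) ≤ δ →
          (∑ i, (a i z - ε) * |x i - y i|) ≤
              F x + F y - 2 * F (fun i => min (x i) (y i)) ∧
          F x + F y - 2 * F (fun i => min (x i) (y i)) ≤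
              ∑ i, (a i z + ε) * |x i - y i| := by
  intro ε hε _
  obtain ⟨δ, hδ, h⟩ := hFEXM ε hε
  refine ⟨δ / 2, by positivity, fun z hz x hx y hy hxz hyz => ?_⟩
  set m : Fin n → ℝ := fun i => min (x i) (y i)
  have hm : m ∈ Set.Icc (0 : Fin n → ℝ) 1 :=
    ⟨fun i => le_min (hx.1 i) (hy.1 i), fun i => (min_le_left _ _).trans (hx.2 i)⟩
  have hmz : ∑ i, |m i - z i| ≤ δ := by
    have hle : ∑ i, |m i - z i| ≤ ∑ i, (|x i - z i| + |y i - z i|) := by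
      refine Finset.sum_le_sum fun i _ => ?_
      rcases min_choice (x i) (y i) with hi | hi <;> simp only [m, hi] <;>
        linarith [abs_nonneg (x i - z i), abs_nonneg (y i - z i)]
    rw [Finset.sum_add_distrib] at hle
    linarith
  have hxm := abs_le.mp (h z hz x hx m hm (by linarith) hmz)
  have hym := abs_le.mp (h z hz y hy m hm (by linarith) hmz)
  have hlin : ∑ i, a i z * (x i - m i) + ∑ i, a i z * (y i - m i) =
      ∑ i, a i z * |x i - y i| := by
    rw [← Finset.sum_add_distrib]
    refine Finset.sum_congr rfl fun i _ => ?_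
    rw [← mul_add]
    congr 1
    linarith [min_add_max (x i) (y i), max_sub_min_eq_abs' (x i) (y i)]
  have habs : ∑ i, |x i - m i| + ∑ i, |y i - m i| = ∑ i, |x i - y i| := by
    rw [← Finset.sum_add_distrib]
    refine Finset.sum_congr rfl fun i _ => ?_
    rw [abs_of_nonneg (sub_nonneg.mpr (min_le_left (x i) (y i))),
      abs_of_nonneg (sub_nonneg.mpr (min_le_right (x i) (y i)))]
    linarith [min_add_max (x i) (y i), max_sub_min_eq_abs' (x i) (y i)]
  have herr : ε * ∑ i, |x i - m i| + ε * ∑ i, |y i - m i| = ε * ∑ i, |x i - y i| := by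
    rw [← mul_add, habs]
  simp only [sub_mul, add_mul, Finset.sum_sub_distrib, Finset.sum_add_distrib, ← Finset.mul_sum]
  constructor <;> linarith [hxm.1, hxm.2, hym.1, hym.2]
end

section
/- There exist δ > 0 and constants 0 < c ≤ C such that for all z ∈ D and all x, y ∈ [0,1]^n with ∑_{i=1}^n |x_i − z_i| ≤ δ, ∑_{i=1}^n |y_i − z_i| ≤ δ and y_i ≤ x_i for every i, one has c·∑_{i=1}^n (x_i − y_i) ≤ F(x) − F(y) ≤ C·∑_{i=1}^n (x_i − y_i). In particular, F is strictly increasing along every line parallel to a coordinate axis within the set E(δ) = {x ∈ [0,1]^n : ∃ z ∈ D with ∑_{i=1}^n |x_i − z_i| ≤ δ}. -/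
open Filter Topology

/-- A continuous function on `[0, 1]` that starts at level `l`, and that is locally strictly
separated by the level `l` (in the increasing direction) wherever it takes this value, does not
return to level `l` at `1`. -/
theorem ne_of_forall_crossing_upward {g : ℝ → ℝ} {l : ℝ} (hg : ContinuousOn g (Set.Icc 0 1))
    (hg0 : g 0 = l)
    (hup : ∀ s ∈ Set.Icc (0 : ℝ) 1, g s = l → ∃ r > 0, ∀ t ∈ Set.Icc (0 : ℝ) 1, |t - s| ≤ r →
      (s < t → l < g t) ∧ (t < s → g t < l)) :
    g 1 ≠ l := by
  intro hg1
  obtain ⟨r, hr, h⟩ := hup 0 (by simp) hg0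
  set t₀ := min r 1
  have ht₀ : 0 < t₀ := lt_min hr one_pos
  have ht₀1 : t₀ ≤ 1 := min_le_right _ _
  have hgt₀ : l < g t₀ :=
    (h t₀ ⟨ht₀.le, ht₀1⟩ (by rw [sub_zero, abs_of_pos ht₀]; exact min_le_left _ _)).1 ht₀
  have hg' : ContinuousOn g (Set.Icc t₀ 1) := hg.mono (Set.Icc_subset_Icc_left ht₀.le)
  have hcomp : IsCompact (Set.Icc t₀ 1 ∩ g ⁻¹' {l}) :=
    isCompact_Icc.of_isClosed_subset (hg'.preimage_isClosed_of_isClosed isClosed_Icc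
      isClosed_singleton) Set.inter_subset_left
  obtain ⟨s, ⟨⟨hs0, hs1⟩, hs⟩, hmin⟩ := hcomp.exists_isLeast ⟨1, ⟨ht₀1, le_rfl⟩, hg1⟩
  have hs : g s = l := hs
  have hlt : t₀ < s := lt_of_le_of_ne hs0 (by rintro e; rw [e] at hgt₀; exact hgt₀.ne' hs)
  obtain ⟨ρ, hρ, h'⟩ := hup s ⟨by linarith, hs1⟩ hs
  set t := max t₀ (s - ρ)
  have htt : t₀ ≤ t := le_max_left _ _
  have hts : t < s := max_lt hlt (by linarith)
  have hρt : s - ρ ≤ t := le_max_right _ _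
  have hgt : g t < l :=
    (h' t ⟨by linarith, by linarith⟩ (by rw [abs_le]; constructor <;> linarith)).2 hts
  obtain ⟨u, ⟨hu0, hu1⟩, hu⟩ := intermediate_value_Icc' htt
    (hg'.mono (Set.Icc_subset_Icc_right (by linarith))) ⟨hgt.le, hgt₀.le⟩
  have := hmin ⟨⟨hu0, by linarith⟩, hu⟩
  linarith

/-- A family of positive continuous functions on a nonempty compact set has common positive
lower and upper bounds. -/
theorem exists_pos_bounds_of_continuousOn {ι X : Type*} [Finite ι] [Nonempty ι]
    [TopologicalSpace X] {K : Set X} (hK : IsCompact K) (hne : K.Nonempty) {a : ι → X → ℝ}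
    (ha : ∀ i, ContinuousOn (a i) K) (hpos : ∀ i, ∀ z ∈ K, 0 < a i z) :
    ∃ m M : ℝ, 0 < m ∧ ∀ i, ∀ z ∈ K, m ≤ a i z ∧ a i z ≤ M := by
  choose p hp hmin using fun i => hK.exists_isMinOn hne (ha i)
  choose q hq hmax using fun i => hK.exists_isMaxOn hne (ha i)
  obtain ⟨i₀, hi₀⟩ := Finite.exists_min fun i => a i (p i)
  obtain ⟨i₁, hi₁⟩ := Finite.exists_max fun i => a i (q i)
  exact ⟨a i₀ (p i₀), a i₁ (q i₁), hpos _ _ (hp _), fun i z hz =>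
    ⟨(hi₀ i).trans (hmin i hz), le_trans (hmax i hz) (hi₁ i)⟩⟩

/-- A linear approximation with coefficients in `[m, M]` and error at most `ε` in the `ℓ¹` norm
yields two-sided bounds on increments between ordered points. -/
theorem increment_bounds_of_abs_sub_sum_le {ι : Type*} [Fintype ι] {b x y : ι → ℝ}
    {d ε m M : ℝ} (hb : ∀ i, m ≤ b i ∧ b i ≤ M) (hyx : y ≤ x)
    (h : |d - ∑ i, b i * (x i - y i)| ≤ ε * ∑ i, |x i - y i|) :
    (m - ε) * ∑ i, (x i - y i) ≤ d ∧ d ≤ (M + ε) * ∑ i, (x i - y i) := by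
  have habs : ∑ i, |x i - y i| = ∑ i, (x i - y i) :=
    Finset.sum_congr rfl fun i _ => abs_of_nonneg (sub_nonneg.2 (hyx i))
  have hlow : m * ∑ i, (x i - y i) ≤ ∑ i, b i * (x i - y i) := by
    rw [Finset.mul_sum]
    exact Finset.sum_le_sum fun i _ => mul_le_mul_of_nonneg_right (hb i).1 (sub_nonneg.2 (hyx i))
  have hupp : ∑ i, b i * (x i - y i) ≤ M * ∑ i, (x i - y i) := by
    rw [Finset.mul_sum]
    exact Finset.sum_le_sum fun i _ => mul_le_mul_of_nonneg_right (hb i).2 (sub_nonneg.2 (hyx i))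
  rw [habs, abs_le] at h
  constructor <;> linarith [h.1, h.2]

theorem sum_sub_pos_of_lt {ι : Type*} [Fintype ι] {x y : ι → ℝ} (h : y < x) :
    0 < ∑ i, (x i - y i) := by
  obtain ⟨hle, i, hi⟩ := Pi.lt_def.1 h
  exact Finset.sum_pos' (fun j _ => sub_nonneg.2 (hle j)) ⟨i, Finset.mem_univ i, sub_pos.2 hi⟩

section LevelSet

variable {ι : Type*} [Fintype ι] {F : (ι → ℝ) → ℝ} {D : Set (ι → ℝ)} {l δ : ℝ}

/-- Two distinct points of a level set cannot be comparable if the function is strictly increasing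
near each point of the level set. -/
theorem not_lt_of_strictMono_near_level (hF : ContinuousOn F (Set.Icc 0 1))
    (hD : D = {x ∈ Set.Icc (0 : ι → ℝ) 1 | F x = l}) (hδ : 0 < δ)
    (hmono : ∀ z ∈ D, ∀ x ∈ Set.Icc (0 : ι → ℝ) 1, ∀ y ∈ Set.Icc (0 : ι → ℝ) 1,
      (∑ i, |x i - z i|) ≤ δ → (∑ i, |y i - z i|) ≤ δ → y < x → F y < F x)
    {x y : ι → ℝ} (hx : x ∈ D) (hy : y ∈ D) : ¬ y < x := by
  intro hlt
  have hS := sum_sub_pos_of_lt hlt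
  set S := ∑ i, (x i - y i) with hSdef
  set γ : ℝ → ι → ℝ := fun t => AffineMap.lineMap y x t with hγ
  have hγi : ∀ t i, γ t i = y i + t * (x i - y i) := by
    intro t i
    simp [hγ, AffineMap.lineMap_apply]
    ring
  have hxD := hx
  have hyD := hy
  rw [hD] at hxD hyD
  have hmem : ∀ t ∈ Set.Icc (0 : ℝ) 1, γ t ∈ Set.Icc (0 : ι → ℝ) 1 := fun t ht =>
    (convex_Icc _ _).lineMap_mem hyD.1 hxD.1 ht
  have hγlt : ∀ s t : ℝ, s < t → γ s < γ t := by
    intro s t hst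
    obtain ⟨hle, i, hi⟩ := Pi.lt_def.1 hlt
    refine Pi.lt_def.2 ⟨fun j => ?_, i, ?_⟩
    · rw [hγi, hγi]
      have := hle j
      nlinarith
    · rw [hγi, hγi]
      nlinarith
  have hdist : ∀ s t : ℝ, ∑ i, |γ t i - γ s i| = |t - s| * S := by
    intro s t
    rw [hSdef, Finset.mul_sum]
    refine Finset.sum_congr rfl fun i _ => ?_
    rw [hγi, hγi, show y i + t * (x i - y i) - (y i + s * (x i - y i)) = (t - s) * (x i - y i) by
      ring, abs_mul, abs_of_nonneg (sub_nonneg.2 (hlt.le i))]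
  have hcont : ContinuousOn (F ∘ γ) (Set.Icc 0 1) :=
    hF.comp (AffineMap.lineMap_continuous.continuousOn) hmem
  refine ne_of_forall_crossing_upward (l := l) hcont (by simpa [hγ] using hyD.2) ?_
    (by simpa [hγ] using hxD.2)
  intro s hs hgs
  have hsD : γ s ∈ D := by
    rw [hD]
    exact ⟨hmem s hs, hgs⟩
  have hself : ∑ i, |γ s i - γ s i| ≤ δ := by simpa using hδ.le
  refine ⟨δ / S, div_pos hδ hS, fun t ht hts => ?_⟩
  have hnear : ∑ i, |γ t i - γ s i| ≤ δ := by
    rw [hdist]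
    exact (le_div_iff₀ hS).1 hts
  rw [← hgs]
  exact ⟨fun h => hmono _ hsD _ (hmem t ht) _ (hmem s hs) hnear hself (hγlt _ _ h),
    fun h => hmono _ hsD _ (hmem s hs) _ (hmem t ht) hself hnear (hγlt _ _ h)⟩

theorem tendsto_of_sum_abs_sub_le {x z : ℕ → ι → ℝ} {w : ι → ℝ} {r : ℕ → ℝ}
    (hr : Tendsto r atTop (𝓝 0)) (hxz : ∀ k, ∑ i, |x k i - z k i| ≤ r k)
    (hz : Tendsto z atTop (𝓝 w)) : Tendsto x atTop (𝓝 w) := by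
  have hsub : Tendsto (fun k => x k - z k) atTop (𝓝 0) := by
    refine tendsto_pi_nhds.2 fun i => squeeze_zero_norm (fun k => ?_) hr
    exact (Finset.single_le_sum (f := fun i => |x k i - z k i|) (fun _ _ => abs_nonneg _)
      (Finset.mem_univ i)).trans (hxz k)
  simpa using hsub.add hz

/-- Strict monotonicity near each point of a level set extends to strict monotonicity on a whole
neighbourhood of the level set. -/
theorem exists_strictMono_nhd_level (hF : ContinuousOn F (Set.Icc 0 1))
    (hD : D = {x ∈ Set.Icc (0 : ι → ℝ) 1 | F x = l}) (hDc : IsCompact D) (hδ : 0 < δ)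
    (hmono : ∀ z ∈ D, ∀ x ∈ Set.Icc (0 : ι → ℝ) 1, ∀ y ∈ Set.Icc (0 : ι → ℝ) 1,
      (∑ i, |x i - z i|) ≤ δ → (∑ i, |y i - z i|) ≤ δ → y < x → F y < F x) :
    ∃ η > 0, ∀ x ∈ Set.Icc (0 : ι → ℝ) 1, ∀ y ∈ Set.Icc (0 : ι → ℝ) 1,
      (∃ z ∈ D, (∑ i, |x i - z i|) ≤ η) → (∃ z ∈ D, (∑ i, |y i - z i|) ≤ η) →
      y < x → F y < F x := by
  by_contra! hcon
  choose x hx y hy hxD hyD hlt hle using fun k : ℕ => hcon (1 / ((k : ℝ) + 1)) (by positivity)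
  choose p hp hxp using hxD
  choose q hq hyq using hyD
  obtain ⟨⟨p', q'⟩, ⟨hp', hq'⟩, φ, hφ, hlim⟩ :=
    (hDc.prod hDc).tendsto_subseq (x := fun k => (p k, q k)) fun k => ⟨hp k, hq k⟩
  have hr : Tendsto (fun k => 1 / ((φ k : ℝ) + 1)) atTop (𝓝 0) :=
    tendsto_one_div_add_atTop_nhds_zero_nat.comp hφ.tendsto_atTop
  have hxlim : Tendsto (x ∘ φ) atTop (𝓝 p') :=
    tendsto_of_sum_abs_sub_le hr (fun k => hxp (φ k)) ((continuous_fst.tendsto _).comp hlim)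
  have hylim : Tendsto (y ∘ φ) atTop (𝓝 q') :=
    tendsto_of_sum_abs_sub_le hr (fun k => hyq (φ k)) ((continuous_snd.tendsto _).comp hlim)
  have hqp : q' ≤ p' := le_of_tendsto_of_tendsto' hylim hxlim fun k => (hlt (φ k)).le
  obtain rfl : q' = p' := by
    by_contra hne
    exact not_lt_of_strictMono_near_level hF hD hδ hmono hp' hq' (lt_of_le_of_ne hqp hne)
  have hnear : ∀ᶠ w in 𝓝 q', ∑ i, |w i - q' i| ≤ δ := by
    have hc : Continuous fun w : ι → ℝ => ∑ i, |w i - q' i| := by fun_prop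
    exact (hc.tendsto q').eventually_le_const (by simpa using hδ)
  obtain ⟨k, hk₁, hk₂⟩ := ((hxlim.eventually hnear).and (hylim.eventually hnear)).exists
  exact (hle (φ k)).not_gt (hmono q' hq' _ (hx _) _ (hy _) hk₁ hk₂ (hlt _))

end LevelSet


/-- Under condition (FEXM), there exist `δ > 0` and constants
`0 < c ≤ C` such that near every `z ∈ D`, for componentwise-ordered `x, y`,
`c ∑ (x_i - y_i) ≤ F(x) - F(y) ≤ C ∑ (x_i - y_i)`; in particular `F` is strictly
increasing along every line parallel to a coordinate axis within
`E(δ) = {x ∈ [0,1]^n : ∃ z ∈ D, ∑ |x_i - z_i| ≤ δ}`. -/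
theorem stmt_8 (n : ℕ) (hn : 2 ≤ n)
    (F : (Fin n → ℝ) → ℝ)
    (hFcont : ContinuousOn F (Set.Icc (0 : Fin n → ℝ) 1))
    (D : Set (Fin n → ℝ))
    (hD : D = {x ∈ Set.Icc (0 : Fin n → ℝ) 1 | F x = 1 / 2})
    (hDne : D.Nonempty)
    (a : Fin n → (Fin n → ℝ) → ℝ)
    (ha_cont : ∀ i, ContinuousOn (a i) D)
    (ha_pos : ∀ i, ∀ z ∈ D, 0 < a i z)
    (hFEXM : ∀ ε > (0 : ℝ), ∃ δ > (0 : ℝ), ∀ z ∈ D,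
      ∀ x ∈ Set.Icc (0 : Fin n → ℝ) 1, ∀ y ∈ Set.Icc (0 : Fin n → ℝ) 1,
        (∑ i, |x i - z i|) ≤ δ → (∑ i, |y i - z i|) ≤ δ →
        |F x - F y - ∑ i, a i z * (x i - y i)| ≤ ε * ∑ i, |x i - y i|) :
    ∃ δ > (0 : ℝ), ∃ c C : ℝ, 0 < c ∧ c ≤ C ∧
      (∀ z ∈ D, ∀ x ∈ Set.Icc (0 : Fin n → ℝ) 1, ∀ y ∈ Set.Icc (0 : Fin n → ℝ) 1,
          (∑ i, |x i - z i|) ≤ δ → (∑ i, |y i - z i|) ≤ δ → (∀ i, y i ≤ x i) →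
          c * (∑ i, (x i - y i)) ≤ F x - F y ∧
          F x - F y ≤ C * ∑ i, (x i - y i)) ∧
      (∀ x y : Fin n → ℝ,
          x ∈ {w ∈ Set.Icc (0 : Fin n → ℝ) 1 | ∃ z ∈ D, (∑ i, |w i - z i|) ≤ δ} →
          y ∈ {w ∈ Set.Icc (0 : Fin n → ℝ) 1 | ∃ z ∈ D, (∑ i, |w i - z i|) ≤ δ} →
          ∀ i : Fin n, (∀ j, j ≠ i → x j = y j) → y i < x i → F y < F x) := by
  have : Nonempty (Fin n) := ⟨⟨0, by omega⟩⟩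
  have hDc : IsCompact D := by
    rw [hD]
    exact isCompact_Icc.of_isClosed_subset
      (hFcont.preimage_isClosed_of_isClosed isClosed_Icc isClosed_singleton) Set.inter_subset_left
  obtain ⟨m, M, hm, hmM⟩ := exists_pos_bounds_of_continuousOn hDc hDne ha_cont ha_pos
  obtain ⟨δ, hδ, hlin⟩ := hFEXM (m / 2) (by positivity)
  have hbounds : ∀ z ∈ D, ∀ x ∈ Set.Icc (0 : Fin n → ℝ) 1, ∀ y ∈ Set.Icc (0 : Fin n → ℝ) 1,
      (∑ i, |x i - z i|) ≤ δ → (∑ i, |y i - z i|) ≤ δ → y ≤ x →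
      (m - m / 2) * (∑ i, (x i - y i)) ≤ F x - F y ∧
        F x - F y ≤ (M + m / 2) * ∑ i, (x i - y i) := fun z hz x hx y hy hxz hyz hyx =>
    increment_bounds_of_abs_sub_sum_le (fun i => hmM i z hz) hyx (hlin z hz x hx y hy hxz hyz)
  obtain ⟨η, hη, hstrict⟩ := exists_strictMono_nhd_level hFcont hD hDc hδ
    fun z hz x hx y hy hxz hyz hyx => by
      have hpos := mul_pos (half_pos hm) (sum_sub_pos_of_lt hyx)
      have := (hbounds z hz x hx y hy hxz hyz hyx.le).1
      linarith
  have hmM' : m ≤ M := by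
    obtain ⟨z, hz⟩ := hDne
    obtain ⟨h₁, h₂⟩ := hmM (Classical.arbitrary _) z hz
    exact h₁.trans h₂
  refine ⟨min δ η, lt_min hδ hη, m - m / 2, M + m / 2, by linarith, by linarith, ?_, ?_⟩
  · intro z hz x hx y hy hxz hyz hyx
    exact hbounds z hz x hx y hy (hxz.trans (min_le_left _ _)) (hyz.trans (min_le_left _ _)) hyx
  · rintro x y ⟨hx, p, hp, hxp⟩ ⟨hy, q, hq, hyq⟩ i hij hi
    refine hstrict x hx y hy ⟨p, hp, hxp.trans (min_le_right _ _)⟩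
      ⟨q, hq, hyq.trans (min_le_right _ _)⟩ (Pi.lt_def.2 ⟨fun j => ?_, i, hi⟩)
    rcases eq_or_ne j i with rfl | hj
    · exact hi.le
    · exact (hij j hj).ge
end

section
/- There exist δ > 0 and Q > 0 such that for all x', y' ∈ L with ∑_{i=1}^{n−1} |x'_i − y'_i| ≤ δ one has |h(x') − h(y')| ≤ Q · ∑_{i=1}^{n−1} |x'_i − y'_i|. -/
/-- On a compact set on which the projection forgetting the last coordinate is injective, the last
coordinate depends uniformly continuously on the others. -/
theorem IsCompact.exists_abs_last_sub_lt {m : ℕ} {D : Set (Fin (m + 1) → ℝ)} (hD : IsCompact D)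
    (hinj : ∀ p ∈ D, ∀ q ∈ D, (∀ i : Fin m, p i.castSucc = q i.castSucc) →
      p (Fin.last m) = q (Fin.last m)) {η : ℝ} (hη : 0 < η) :
    ∃ δ > (0 : ℝ), ∀ p ∈ D, ∀ q ∈ D,
      (∑ i : Fin m, |p i.castSucc - q i.castSucc|) ≤ δ →
        |p (Fin.last m) - q (Fin.last m)| < η := by
  let K : Set ((Fin (m + 1) → ℝ) × (Fin (m + 1) → ℝ)) :=
    (D ×ˢ D) ∩ {r | η ≤ |r.1 (Fin.last m) - r.2 (Fin.last m)|}
  have hK : IsCompact K :=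
    (hD.prod hD).inter_right (isClosed_le (by fun_prop) (by fun_prop))
  rcases K.eq_empty_or_nonempty with hE | hne
  · refine ⟨1, one_pos, fun p hp q hq _ => ?_⟩
    by_contra! hc
    exact (hE.subset (show (p, q) ∈ K from ⟨⟨hp, hq⟩, hc⟩)).elim
  · obtain ⟨r, hr, hmin⟩ := hK.exists_isMinOn hne
      (f := fun r => ∑ i : Fin m, |r.1 i.castSucc - r.2 i.castSucc|) (by fun_prop)
    have hpos : 0 < ∑ i : Fin m, |r.1 i.castSucc - r.2 i.castSucc| := by
      refine lt_of_le_of_ne (Finset.sum_nonneg fun i _ => abs_nonneg _) fun h0 => ?_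
      have hz := (Finset.sum_eq_zero_iff_of_nonneg fun i _ => abs_nonneg _).1 h0.symm
      have hlast := hinj r.1 hr.1.1 r.2 hr.1.2 fun i =>
        sub_eq_zero.1 (abs_eq_zero.1 (hz i (Finset.mem_univ i)))
      have hη' : η ≤ |r.1 (Fin.last m) - r.2 (Fin.last m)| := hr.2
      rw [hlast, sub_self, abs_zero] at hη'
      linarith
    refine ⟨_, half_pos hpos, fun p hp q hq hpq => ?_⟩
    by_contra! hc
    have hle : (∑ i : Fin m, |r.1 i.castSucc - r.2 i.castSucc|) ≤
        ∑ i : Fin m, |p i.castSucc - q i.castSucc| :=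
      hmin (show (p, q) ∈ K from ⟨⟨hp, hq⟩, hc⟩)
    linarith

/-- If a linear form with coefficients bounded by `M` and last coefficient at least `c` is small
relative to `ℓ¹` size, up to a factor `c / 2`, at a vector, then the last coordinate of the vector
is controlled by the others. -/
theorem abs_last_le_of_abs_sum_mul_le {m : ℕ} {b v : Fin (m + 1) → ℝ} {c M : ℝ} (hc : 0 < c)
    (hb : ∀ i, |b i| ≤ M) (hlast : c ≤ b (Fin.last m))
    (h : |∑ i, b i * v i| ≤ c / 2 * ∑ i, |v i|) :
    |v (Fin.last m)| ≤ (2 * M / c + 1) * ∑ i : Fin m, |v i.castSucc| := by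
  rw [Fin.sum_univ_castSucc, Fin.sum_univ_castSucc] at h
  set S := ∑ i : Fin m, |v i.castSucc| with hS
  have h1 : |∑ i : Fin m, b i.castSucc * v i.castSucc| ≤ M * S := by
    rw [hS, Finset.mul_sum]
    refine (Finset.abs_sum_le_sum_abs _ _).trans (Finset.sum_le_sum fun i _ => ?_)
    rw [abs_mul]
    exact mul_le_mul_of_nonneg_right (hb _) (abs_nonneg _)
  have h2 : c * |v (Fin.last m)| ≤ |b (Fin.last m) * v (Fin.last m)| := by
    rw [abs_mul]
    exact mul_le_mul_of_nonneg_right (hlast.trans (le_abs_self _)) (abs_nonneg _)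
  have h3 := abs_sub_abs_le_abs_add (b (Fin.last m) * v (Fin.last m))
    (∑ i : Fin m, b i.castSucc * v i.castSucc)
  rw [add_comm] at h3
  have h4 : c * |v (Fin.last m)| ≤ (2 * M + c) * S := by linarith
  have h5 : (2 * M / c + 1) * S = (2 * M + c) * S / c := by field_simp
  rw [h5, le_div_iff₀ hc]
  linarith


/-- Under condition (FEXM), if `D` is the graph of `h : L → [0,1]`,
then `h` is locally Lipschitz: there exist `δ > 0` and `Q > 0` such that
`|h x' - h y'| ≤ Q ∑ |x'_i - y'_i|` whenever `x', y' ∈ L` with `∑ |x'_i - y'_i| ≤ δ`. -/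
theorem stmt_9 (n : ℕ) (hn : 2 ≤ n)
    (F : (Fin n → ℝ) → ℝ)
    (hFcont : ContinuousOn F (Set.Icc (0 : Fin n → ℝ) 1))
    (D : Set (Fin n → ℝ))
    (hD : D = {x ∈ Set.Icc (0 : Fin n → ℝ) 1 | F x = 1 / 2})
    (hDne : D.Nonempty)
    (a : Fin n → (Fin n → ℝ) → ℝ)
    (ha_cont : ∀ i, ContinuousOn (a i) D)
    (ha_pos : ∀ i, ∀ z ∈ D, 0 < a i z)
    (hFEXM : ∀ ε > (0 : ℝ), ∃ δ > (0 : ℝ), ∀ z ∈ D,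
      ∀ x ∈ Set.Icc (0 : Fin n → ℝ) 1, ∀ y ∈ Set.Icc (0 : Fin n → ℝ) 1,
        (∑ i, |x i - z i|) ≤ δ → (∑ i, |y i - z i|) ≤ δ →
        |F x - F y - ∑ i, a i z * (x i - y i)| ≤ ε * ∑ i, |x i - y i|)
    (ext : (Fin (n - 1) → ℝ) → ℝ → (Fin n → ℝ))
    (hext : ∀ x' t i, ext x' t i = if h : (i : ℕ) < n - 1 then x' ⟨i, h⟩ else t)
    (L : Set (Fin (n - 1) → ℝ)) (hLcube : L ⊆ Set.Icc 0 1)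
    (h : (Fin (n - 1) → ℝ) → ℝ) (hh : ∀ x' ∈ L, h x' ∈ Set.Icc (0 : ℝ) 1)
    (hDgraph : D = (fun x' => ext x' (h x')) '' L) :
    ∃ δ > (0 : ℝ), ∃ Q > (0 : ℝ), ∀ x' ∈ L, ∀ y' ∈ L,
      (∑ i, |x' i - y' i|) ≤ δ → |h x' - h y'| ≤ Q * ∑ i, |x' i - y' i| := by
  obtain ⟨m, rfl⟩ : ∃ m, n = m + 1 := ⟨n - 1, by omega⟩
  change Set (Fin m → ℝ) at L
  change (Fin m → ℝ) → ℝ at h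
  have ext_castSucc : ∀ x' t (i : Fin m), ext x' t i.castSucc = x' i := fun x' t i => by
    rw [hext, dif_pos (show (i.castSucc : ℕ) < m + 1 - 1 from i.isLt)]
    rfl
  have ext_last : ∀ x' t, ext x' t (Fin.last m) = t := fun x' t => by
    rw [hext, dif_neg (by simp)]
  have mem_D : ∀ x' ∈ L, ext x' (h x') ∈ D := fun x' hx' => hDgraph ▸ ⟨x', hx', rfl⟩
  have hsub : ∀ z ∈ D, z ∈ Set.Icc (0 : Fin (m + 1) → ℝ) 1 ∧ F z = 1 / 2 := fun z hz => by
    rw [hD] at hz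
    exact hz
  have hDc : IsCompact D := by
    have hclosed : IsClosed D := by
      rw [hD]
      exact hFcont.preimage_isClosed_of_isClosed isClosed_Icc isClosed_singleton
    exact isCompact_Icc.of_isClosed_subset hclosed fun z hz => (hsub z hz).1
  have hinj : ∀ p ∈ D, ∀ q ∈ D, (∀ i : Fin m, p i.castSucc = q i.castSucc) →
      p (Fin.last m) = q (Fin.last m) := by
    intro p hp q hq hpq
    rw [hDgraph] at hp hq
    obtain ⟨x', -, rfl⟩ := hp
    obtain ⟨y', -, rfl⟩ := hq
    have hxy : x' = y' := funext fun i => by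
      simpa only [ext_castSucc] using hpq i
    rw [hxy]
  obtain ⟨z₀, hz₀, hmin⟩ := hDc.exists_isMinOn hDne (ha_cont (Fin.last m))
  have hc := ha_pos (Fin.last m) z₀ hz₀
  obtain ⟨z₁, hz₁, hmax⟩ := hDc.exists_isMaxOn hDne
    (continuousOn_finsetSum Finset.univ fun i _ => ha_cont i)
  set c := a (Fin.last m) z₀
  set M := ∑ i, a i z₁
  have hM : 0 ≤ M := Finset.sum_nonneg fun i _ => (ha_pos i z₁ hz₁).le
  have hbound : ∀ z ∈ D, ∀ i, |a i z| ≤ M := fun z hz i => by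
    rw [abs_of_pos (ha_pos i z hz)]
    exact (Finset.single_le_sum (f := fun i => a i z) (fun j _ => (ha_pos j z hz).le)
      (Finset.mem_univ i)).trans (hmax hz)
  obtain ⟨δ₀, hδ₀, hF⟩ := hFEXM (c / 2) (half_pos hc)
  obtain ⟨δ₁, hδ₁, hlast⟩ := hDc.exists_abs_last_sub_lt hinj (half_pos hδ₀)
  refine ⟨min (δ₀ / 2) δ₁, lt_min (half_pos hδ₀) hδ₁, 2 * M / c + 1, by positivity, ?_⟩
  intro x' hx' y' hy' hxy
  change (∑ i : Fin m, |x' i - y' i|) ≤ _ at hxy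
  have hp := mem_D x' hx'
  have hq := mem_D y' hy'
  have hl := hlast _ hp _ hq (by
    simp only [ext_castSucc]
    exact hxy.trans (min_le_right _ _))
  have hsum : (∑ i, |ext x' (h x') i - ext y' (h y') i|) ≤ δ₀ := by
    rw [Fin.sum_univ_castSucc]
    simp only [ext_castSucc]
    linarith [hxy.trans (min_le_left _ _)]
  have hlin := hF _ hq _ (hsub _ hp).1 _ (hsub _ hq).1 hsum (by simpa using hδ₀.le)
  rw [(hsub _ hp).2, (hsub _ hq).2, sub_self, zero_sub, abs_neg] at hlin
  have key := abs_last_le_of_abs_sum_mul_le (b := fun i => a i (ext y' (h y')))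
    (v := fun i => ext x' (h x') i - ext y' (h y') i) hc (hbound _ hq) (hmin hq) hlin
  simp only [ext_castSucc, ext_last] at key
  exact key
end

section
/- For every ε > 0 there exists δ > 0 such that for all x' ∈ L and all x_n ∈ [0,1] with 0 < |x_n − h(x')| ≤ δ, the point x = (x', x_n) satisfies | (1 − 2√(F(x)(1 − F(x)))) / (2 · a_n(x', h(x'))² · (x_n − h(x'))²) − 1 | ≤ ε. -/
/-- Second-order expansion of the Hellinger-type defect `1 - 2√(p(1-p))` around `p = 1/2`,
in quantitative form: if `p - 1/2` is close to `m` in relative error, then the defect is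
close to `2m²` in relative error. -/
lemma abs_one_sub_two_sqrt_div_sub_one_le {p m τ ε : ℝ} (hm : m ≠ 0)
    (hτ1 : τ ≤ 1) (hτ : 6 * τ ≤ ε) (hp : |p - 1 / 2 - m| ≤ τ * |m|)
    (hm1 : 16 * m ^ 2 ≤ 1) (hmε : 128 * m ^ 2 ≤ ε) :
    |(1 - 2 * Real.sqrt (p * (1 - p))) / (2 * m ^ 2) - 1| ≤ ε := by
  obtain ⟨u, rfl⟩ : ∃ u, p = 1 / 2 + u := ⟨p - 1 / 2, by ring⟩
  have hdiff : |u - m| ≤ τ * |m| := by simpa using hp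
  have hm0 : 0 < |m| := abs_pos.mpr hm
  have hm2 : 0 < m ^ 2 := by positivity
  have hτ0 : 0 ≤ τ := by
    by_contra! hneg
    nlinarith [abs_nonneg (u - m)]
  have hsum : |u + m| ≤ 3 * |m| := by
    calc |u + m| = |(u - m) + 2 * m| := by ring_nf
      _ ≤ |u - m| + |2 * m| := abs_add_le _ _
      _ ≤ 3 * |m| := by rw [abs_mul, abs_two]; nlinarith
  have hsq : |u ^ 2 - m ^ 2| ≤ 3 * τ * m ^ 2 := by
    calc |u ^ 2 - m ^ 2| = |u - m| * |u + m| := by rw [← abs_mul]; ring_nf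
      _ ≤ (τ * |m|) * (3 * |m|) := by gcongr
      _ = 3 * τ * m ^ 2 := by rw [← sq_abs m]; ring
  obtain ⟨hlow, hupp⟩ := abs_le.mp hsq
  have hu : u ^ 2 ≤ 4 * m ^ 2 := by nlinarith
  have harg : (1 / 2 + u) * (1 - (1 / 2 + u)) = 1 / 4 - u ^ 2 := by ring
  rw [harg]
  set q := Real.sqrt (1 / 4 - u ^ 2) with hq
  have hq0 : 0 ≤ q := Real.sqrt_nonneg _
  have hq2 : q ^ 2 = 1 / 4 - u ^ 2 := Real.sq_sqrt (by linarith)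
  have hqhalf : q ≤ 1 / 2 := by nlinarith [sq_nonneg u]
  have hdefect : 1 - 2 * q ≤ 4 * u ^ 2 := by nlinarith
  have hdefect_sq : (1 - 2 * q) ^ 2 ≤ 256 * m ^ 2 * m ^ 2 := by
    have := pow_le_pow_left₀ (by linarith) (hdefect.trans (by linarith : _ ≤ 16 * m ^ 2)) 2
    linarith
  have hid : 1 - 2 * q = 2 * u ^ 2 + (1 - 2 * q) ^ 2 / 2 := by linarith
  have hquot : (1 - 2 * q) / (2 * m ^ 2) - 1 = (1 - 2 * q - 2 * m ^ 2) / (2 * m ^ 2) := by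
    field_simp
  rw [hquot, abs_div, abs_of_pos (by positivity : 0 < 2 * m ^ 2), div_le_iff₀ (by positivity)]
  have hτm : 6 * τ * m ^ 2 ≤ ε * m ^ 2 := by gcongr
  have hεm : 128 * m ^ 2 * m ^ 2 ≤ ε * m ^ 2 := by gcongr
  rw [abs_le]
  constructor <;> nlinarith [sq_nonneg (1 - 2 * q)]


/-- Under condition (FEXM), with `D` the graph of `h : L → [0,1]`,
for every `ε > 0` there is `δ > 0` such that for all `x' ∈ L` and `x_n ∈ [0,1]`
with `0 < |x_n - h(x')| ≤ δ`, the point `x = (x', x_n)` satisfies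
`| (1 - 2√(F(x)(1-F(x)))) / (2 a_n(x',h(x'))² (x_n - h(x'))²) - 1 | ≤ ε`. -/
theorem stmt_10 (n : ℕ) (hn : 2 ≤ n)
    (F : (Fin n → ℝ) → ℝ)
    (hFcont : ContinuousOn F (Set.Icc (0 : Fin n → ℝ) 1))
    (D : Set (Fin n → ℝ))
    (hD : D = {x ∈ Set.Icc (0 : Fin n → ℝ) 1 | F x = 1 / 2})
    (hDne : D.Nonempty)
    (a : Fin n → (Fin n → ℝ) → ℝ)
    (ha_cont : ∀ i, ContinuousOn (a i) D)
    (ha_pos : ∀ i, ∀ z ∈ D, 0 < a i z)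
    (hFEXM : ∀ ε > (0 : ℝ), ∃ δ > (0 : ℝ), ∀ z ∈ D,
      ∀ x ∈ Set.Icc (0 : Fin n → ℝ) 1, ∀ y ∈ Set.Icc (0 : Fin n → ℝ) 1,
        (∑ i, |x i - z i|) ≤ δ → (∑ i, |y i - z i|) ≤ δ →
        |F x - F y - ∑ i, a i z * (x i - y i)| ≤ ε * ∑ i, |x i - y i|)
    (ext : (Fin (n - 1) → ℝ) → ℝ → (Fin n → ℝ))
    (hext : ∀ x' t i, ext x' t i = if h : (i : ℕ) < n - 1 then x' ⟨i, h⟩ else t)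
    (L : Set (Fin (n - 1) → ℝ)) (hLcube : L ⊆ Set.Icc 0 1)
    (h : (Fin (n - 1) → ℝ) → ℝ) (hh : ∀ x' ∈ L, h x' ∈ Set.Icc (0 : ℝ) 1)
    (hDgraph : D = (fun x' => ext x' (h x')) '' L) :
    ∀ ε > (0 : ℝ), ∃ δ > (0 : ℝ), ∀ x' ∈ L, ∀ xn ∈ Set.Icc (0 : ℝ) 1,
      0 < |xn - h x'| → |xn - h x'| ≤ δ →
      |(1 - 2 * Real.sqrt (F (ext x' xn) * (1 - F (ext x' xn)))) /
          (2 * (a ⟨n - 1, by omega⟩ (ext x' (h x'))) ^ 2 * (xn - h x') ^ 2) - 1| ≤ ε := by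
  intro ε hε
  set N : Fin n := ⟨n - 1, by omega⟩ with hN
  have hDcube : D ⊆ Set.Icc (0 : Fin n → ℝ) 1 := fun z hz => (hD ▸ hz).1
  have hDhalf : ∀ z ∈ D, F z = 1 / 2 := fun z hz => (hD ▸ hz).2
  have hDcompact : IsCompact D := by
    have hclosed : IsClosed D := by
      rw [hD]
      exact hFcont.preimage_isClosed_of_isClosed isClosed_Icc (isClosed_singleton (x := 1 / 2))
    exact isCompact_Icc.of_isClosed_subset hclosed hDcube
  obtain ⟨z₀, hz₀, hmin⟩ := hDcompact.exists_isMinOn hDne (ha_cont N)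
  obtain ⟨z₁, hz₁, hmax⟩ := hDcompact.exists_isMaxOn hDne (ha_cont N)
  have hc := ha_pos N z₀ hz₀
  have hC := ha_pos N z₁ hz₁
  set c := a N z₀
  set C := a N z₁
  set τ := min 1 (ε / 6)
  have hτ0 : 0 < τ := lt_min one_pos (by linarith)
  have hτ1 : τ ≤ 1 := min_le_left _ _
  have hτε : 6 * τ ≤ ε := by linarith [min_le_right 1 (ε / 6)]
  obtain ⟨δ₀, hδ₀, hexp⟩ := hFEXM (τ * c) (by positivity)
  set κ := min (1 / 16) (ε / 128)
  have hκ0 : 0 < κ := lt_min (by norm_num) (by linarith)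
  refine ⟨min δ₀ (Real.sqrt κ / C), lt_min hδ₀ (by positivity), ?_⟩
  intro x' hx' xn hxn hpos hle
  set s := xn - h x' with hs
  set z := ext x' (h x') with hz
  set x := ext x' xn with hx
  have hzD : z ∈ D := hDgraph ▸ Set.mem_image_of_mem _ hx'
  have hcube : ∀ t ∈ Set.Icc (0 : ℝ) 1, ext x' t ∈ Set.Icc (0 : Fin n → ℝ) 1 := by
    intro t ht
    refine ⟨fun i => ?_, fun i => ?_⟩ <;> rw [hext] <;> split_ifs with hi
    · exact (hLcube hx').1 _
    · exact ht.1
    · exact (hLcube hx').2 _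
    · exact ht.2
  have hdiffN : x N - z N = s := by simp [hx, hz, hs, hext, hN]
  have hdiff : ∀ i, i ≠ N → x i - z i = 0 := by
    intro i hi
    have hlt : (i : ℕ) < n - 1 := by
      have : (i : ℕ) ≠ n - 1 := fun heq => hi (Fin.ext heq)
      omega
    simp [hx, hz, hext, hlt]
  have hsum_abs : ∑ i, |x i - z i| = |s| := by
    rw [Finset.sum_eq_single N (fun i _ hi => by simp [hdiff i hi]) (by simp), hdiffN]
  have hsum : ∑ i, a i z * (x i - z i) = a N z * s := by
    rw [Finset.sum_eq_single N (fun i _ hi => by simp [hdiff i hi]) (by simp), hdiffN]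
  have hF := hexp z hzD x (hcube xn hxn) z (hDcube hzD)
    (hsum_abs.trans_le (hle.trans (min_le_left _ _))) (by simpa using hδ₀.le)
  rw [hsum, hsum_abs, hDhalf z hzD] at hF
  have hA := ha_pos N z hzD
  have hcA : c ≤ a N z := hmin hzD
  have hAC : a N z ≤ C := hmax hzD
  have hm : (a N z * s) ^ 2 ≤ κ := by
    have hCs : C * |s| ≤ Real.sqrt κ := by
      have := hle.trans (min_le_right _ _)
      rw [le_div_iff₀ hC] at this
      linarith
    calc (a N z * s) ^ 2 = (a N z * |s|) ^ 2 := by rw [mul_pow, mul_pow, sq_abs]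
      _ ≤ Real.sqrt κ ^ 2 := by
        gcongr
        exact (mul_le_mul_of_nonneg_right hAC (abs_nonneg s)).trans hCs
      _ = κ := Real.sq_sqrt hκ0.le
  have key := abs_one_sub_two_sqrt_div_sub_one_le (p := F x) (m := a N z * s) (τ := τ) (ε := ε)
    (mul_ne_zero hA.ne' (abs_pos.mp hpos)) hτ1 hτε
    (hF.trans (by rw [abs_mul, abs_of_pos hA, mul_assoc]; gcongr))
    (by linarith [min_le_left (1 / 16) (ε / 128)]) (by linarith [min_le_right (1 / 16) (ε / 128)])
  rwa [mul_pow, ← mul_assoc] at key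
end

section
/- For x, y ∈ [0,1]^n with F(x), F(y) ∈ (0,1), define the correlation r(x, y) = (F(x ∧ y) − F(x)F(y)) / √(F(x)(1 − F(x)) · F(y)(1 − F(y))). Then for every ε > 0 there exists δ > 0 such that for all z ∈ D and all x ≠ y with ∑_{i=1}^n |x_i − z_i| ≤ δ and ∑_{i=1}^n |y_i − z_i| ≤ δ, one has | (1 − r(x, y)) / (2 ∑_{i=1}^n a_i(z) |x_i − y_i|) − 1 | ≤ ε. -/
/-- The scalar estimate behind the correlation asymptotics: if `p, q` are `t`-close to `1/2` and
`p + q - 2w` is `A` up to a relative error `t`, then `1 - r` is `2A` up to a relative error `16t`. -/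
theorem abs_one_sub_corr_div_sub_one_le {p q w A t : ℝ} (ht : 0 < t) (ht8 : t ≤ 1 / 8)
    (hp : |p - 1 / 2| ≤ t) (hq : |q - 1 / 2| ≤ t) (hA : 0 < A)
    (hw : |p + q - 2 * w - A| ≤ t * A) (hpq : |p - q| ≤ 2 * A) :
    |(1 - (w - p * q) / Real.sqrt (p * (1 - p) * (q * (1 - q)))) / (2 * A) - 1| ≤ 16 * t := by
  have hsq : ∀ u : ℝ, |u - 1 / 2| ≤ t → 1 / 4 - t ^ 2 ≤ u * (1 - u) ∧ u * (1 - u) ≤ 1 / 4 := by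
    intro u hu
    have := sq_le_sq' (abs_le.1 hu).1 (abs_le.1 hu).2
    constructor <;> nlinarith [sq_nonneg (u - 1 / 2)]
  obtain ⟨hP1, hP2⟩ := hsq p hp
  obtain ⟨hQ1, hQ2⟩ := hsq q hq
  have ht2 : t ^ 2 ≤ t / 8 := by nlinarith
  set P := p * (1 - p) with hP
  set Q := q * (1 - q) with hQ
  have hP0 : 15 / 64 ≤ P := by linarith
  have hQ0 : 15 / 64 ≤ Q := by linarith
  set V := Real.sqrt (P * Q) with hV
  have hVsq : V ^ 2 = P * Q := Real.sq_sqrt (by positivity)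
  have hVlo : 1 / 4 - t ^ 2 ≤ V := by
    apply Real.le_sqrt_of_sq_le
    nlinarith
  have hVhi : V ≤ 1 / 4 := Real.sqrt_le_iff.2 ⟨by norm_num, by nlinarith⟩
  have hV0 : 15 / 64 ≤ V := by linarith
  obtain ⟨hp1, hp2⟩ := abs_le.1 hp
  obtain ⟨hq1, hq2⟩ := abs_le.1 hq
  have hdiff : (p - q) ^ 2 ≤ 4 * t * A := by
    have h2t : |p - q| ≤ 2 * t := abs_le.2 ⟨by linarith, by linarith⟩
    rw [← sq_abs]
    nlinarith [abs_nonneg (p - q), mul_le_mul h2t hpq (abs_nonneg _) (by linarith)]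
  have hPQ : (P - Q) ^ 2 ≤ (p - q) ^ 2 := by
    have h1 : (P - Q) ^ 2 = (p - q) ^ 2 * (1 - p - q) ^ 2 := by rw [hP, hQ]; ring
    have h2 : (1 - p - q) ^ 2 ≤ 1 := by nlinarith
    rw [h1]
    exact mul_le_of_le_one_right (sq_nonneg _) h2
  have hd0 : 0 ≤ (P + Q) / 2 - V := by
    have : V ≤ (P + Q) / 2 :=
      Real.sqrt_le_iff.2 ⟨by linarith, by nlinarith [sq_nonneg (P - Q)]⟩
    linarith
  have hd1 : (P + Q) / 2 - V ≤ (p - q) ^ 2 := by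
    have h : ((P + Q) / 2 - V) * ((P + Q) / 2 + V) = (P - Q) ^ 2 / 4 := by
      linear_combination -hVsq
    nlinarith [mul_nonneg hd0 (show 0 ≤ (P + Q) / 2 + V - 1 / 4 by linarith)]
  have hmid : (P + Q) / 2 = (p + q) / 2 - p * q - (p - q) ^ 2 / 2 := by rw [hP, hQ]; ring
  obtain ⟨hw1, hw2⟩ := abs_le.1 hw
  have hAt : A * (1 / 4 - V) ≤ A * (t / 8) := by gcongr; linarith
  have hAV : 0 ≤ A * (1 / 4 - V) := mul_nonneg hA.le (by linarith)
  have hAtV : A * t * (15 / 64) ≤ A * t * V := by gcongr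
  have hrw : (1 - (w - p * q) / V) / (2 * A) - 1 =
      (V + p * q - w - 2 * A * V) / (2 * A * V) := by
    have : V ≠ 0 := by linarith
    field_simp
    ring
  have hden : 0 < 2 * A * V := by positivity
  rw [hrw, abs_div, abs_of_pos hden, div_le_iff₀ hden, abs_le]
  have htA := mul_pos ht hA
  constructor <;> linarith

/-- Finitely many positive continuous functions on a compact set have a common positive
lower bound. -/
theorem IsCompact.exists_pos_forall_le_of_continuousOn {ι X : Type*} [Finite ι]
    [TopologicalSpace X] {K : Set X} (hK : IsCompact K) {a : ι → X → ℝ}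
    (ha : ∀ i, ContinuousOn (a i) K) (hpos : ∀ i, ∀ z ∈ K, 0 < a i z) :
    ∃ m > 0, ∀ i, ∀ z ∈ K, m ≤ a i z := by
  have h1 : ∀ i, ∃ m > 0, ∀ z ∈ K, m ≤ a i z := by
    intro i
    rcases K.eq_empty_or_nonempty with rfl | hne
    · exact ⟨1, one_pos, by simp⟩
    · obtain ⟨z, hz, hmin⟩ := hK.exists_isMinOn hne (ha i)
      exact ⟨a i z, hpos i z hz, fun w hw => hmin hw⟩
  choose m hm hle using h1
  cases nonempty_fintype ι
  rcases isEmpty_or_nonempty ι with hι | hι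
  · exact ⟨1, one_pos, fun i => isEmptyElim i⟩
  · refine ⟨Finset.univ.inf' Finset.univ_nonempty m, ?_, fun i z hz => ?_⟩
    · exact (Finset.lt_inf'_iff _).2 fun i _ => hm i
    · exact (Finset.inf'_le m (Finset.mem_univ i)).trans (hle i z hz)


/-- Under condition (FEXM), with the correlation
`r(x,y) = (F(x∧y) - F(x)F(y)) / √(F(x)(1-F(x)) F(y)(1-F(y)))` (well defined near `D`
since there `F(x), F(y) ∈ (0,1)`), for every `ε > 0` there is `δ > 0` such that for
all `z ∈ D` and all `x ≠ y` within `δ` of `z`,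
`| (1 - r(x,y)) / (2 ∑ a_i(z)|x_i - y_i|) - 1| ≤ ε`. -/
theorem stmt_11 (n : ℕ) (hn : 2 ≤ n)
    (F : (Fin n → ℝ) → ℝ)
    (hFcont : ContinuousOn F (Set.Icc (0 : Fin n → ℝ) 1))
    (D : Set (Fin n → ℝ))
    (hD : D = {x ∈ Set.Icc (0 : Fin n → ℝ) 1 | F x = 1 / 2})
    (hDne : D.Nonempty)
    (a : Fin n → (Fin n → ℝ) → ℝ)
    (ha_cont : ∀ i, ContinuousOn (a i) D)
    (ha_pos : ∀ i, ∀ z ∈ D, 0 < a i z)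
    (hFEXM : ∀ ε > (0 : ℝ), ∃ δ > (0 : ℝ), ∀ z ∈ D,
      ∀ x ∈ Set.Icc (0 : Fin n → ℝ) 1, ∀ y ∈ Set.Icc (0 : Fin n → ℝ) 1,
        (∑ i, |x i - z i|) ≤ δ → (∑ i, |y i - z i|) ≤ δ →
        |F x - F y - ∑ i, a i z * (x i - y i)| ≤ ε * ∑ i, |x i - y i|) :
    ∀ ε > (0 : ℝ), ∃ δ > (0 : ℝ), ∀ z ∈ D,
      ∀ x ∈ Set.Icc (0 : Fin n → ℝ) 1, ∀ y ∈ Set.Icc (0 : Fin n → ℝ) 1, x ≠ y →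
        (∑ i, |x i - z i|) ≤ δ → (∑ i, |y i - z i|) ≤ δ →
        F x ∈ Set.Ioo (0 : ℝ) 1 ∧ F y ∈ Set.Ioo (0 : ℝ) 1 ∧
        |(1 - (F (fun i => min (x i) (y i)) - F x * F y) /
              Real.sqrt (F x * (1 - F x) * (F y * (1 - F y)))) /
            (2 * ∑ i, a i z * |x i - y i|) - 1| ≤ ε := by
  intro ε hε
  have hcomp : IsCompact (Set.Icc (0 : Fin n → ℝ) 1) := isCompact_Icc
  have hDcomp : IsCompact D := by
    have hcl : IsClosed D := by
      rw [hD]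
      exact hFcont.preimage_isClosed_of_isClosed hcomp.isClosed (isClosed_singleton (x := 1 / 2))
    exact hcomp.of_isClosed_subset hcl (by rw [hD]; exact fun x hx => hx.1)
  obtain ⟨m, hm, hma⟩ := hDcomp.exists_pos_forall_le_of_continuousOn ha_cont ha_pos
  set t := min (1 / 8) (ε / 16) with ht_def
  have ht : 0 < t := lt_min (by norm_num) (by positivity)
  have ht8 : t ≤ 1 / 8 := min_le_left _ _
  have htε : 16 * t ≤ ε := by linarith [min_le_right (1 / 8) (ε / 16)]
  obtain ⟨δ₁, hδ₁, hF⟩ := hFEXM (t * m / 2) (by positivity)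
  obtain ⟨δ₂, hδ₂, hU⟩ := Metric.uniformContinuousOn_iff_le.1
    (hcomp.uniformContinuousOn_of_continuous hFcont) t ht
  refine ⟨min (δ₁ / 2) δ₂, lt_min (by positivity) hδ₂, fun z hz x hx y hy hxy hxz hyz => ?_⟩
  have hz' : z ∈ Set.Icc (0 : Fin n → ℝ) 1 ∧ F z = 1 / 2 := by rwa [hD] at hz
  have near : ∀ u ∈ Set.Icc (0 : Fin n → ℝ) 1, ∑ i, |u i - z i| ≤ min (δ₁ / 2) δ₂ →
      |F u - 1 / 2| ≤ t := by
    intro u hu huz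
    have hdist : dist u z ≤ δ₂ := (dist_pi_le_iff hδ₂.le).2 fun i =>
      (Finset.single_le_sum (f := fun i => |u i - z i|) (fun j _ => abs_nonneg _)
        (Finset.mem_univ i)).trans (huz.trans (min_le_right _ _))
    have := hU u hu z hz'.1 hdist
    rwa [hz'.2, Real.dist_eq] at this
  have hp := near x hx hxz
  have hq := near y hy hyz
  have hxz' := hxz.trans (min_le_left _ _)
  have hyz' := hyz.trans (min_le_left _ _)
  set v : Fin n → ℝ := fun i => min (x i) (y i) with hv
  have hvI : v ∈ Set.Icc (0 : Fin n → ℝ) 1 :=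
    ⟨fun i => le_min (hx.1 i) (hy.1 i), fun i => (min_le_left _ _).trans (hx.2 i)⟩
  have hvz : ∑ i, |v i - z i| ≤ δ₁ := by
    have : ∑ i, |v i - z i| ≤ ∑ i, (|x i - z i| + |y i - z i|) := by
      refine Finset.sum_le_sum fun i _ => ?_
      rcases min_choice (x i) (y i) with h | h <;> simp only [hv, h] <;>
        linarith [abs_nonneg (x i - z i), abs_nonneg (y i - z i)]
    rw [Finset.sum_add_distrib] at this
    linarith
  have hxv := hF z hz x hx v hvI (by linarith) hvz
  have hyv := hF z hz y hy v hvI (by linarith) hvz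
  have hxy' := hF z hz x hx y hy (by linarith) (by linarith)
  set A := ∑ i, a i z * |x i - y i| with hA
  set S := ∑ i, |x i - y i| with hS
  have hsplit : ∀ i, (x i - v i) + (y i - v i) = |x i - y i| := by
    intro i
    rcases le_total (x i) (y i) with h | h
    · simp only [hv, min_eq_left h, abs_of_nonpos (sub_nonpos.2 h)]; ring
    · simp only [hv, min_eq_right h, abs_of_nonneg (sub_nonneg.2 h)]; ring
  have hsumA : ∑ i, a i z * (x i - v i) + ∑ i, a i z * (y i - v i) = A := by
    rw [← Finset.sum_add_distrib]
    exact Finset.sum_congr rfl fun i _ => by rw [← mul_add, hsplit]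
  have hsumS : ∑ i, |x i - v i| + ∑ i, |y i - v i| = S := by
    rw [← Finset.sum_add_distrib]
    refine Finset.sum_congr rfl fun i _ => ?_
    rw [abs_of_nonneg (sub_nonneg.2 (min_le_left _ _)),
      abs_of_nonneg (sub_nonneg.2 (min_le_right _ _)), hsplit]
  have hmS : m * S ≤ A := by
    rw [hS, Finset.mul_sum]
    exact Finset.sum_le_sum fun i _ => mul_le_mul_of_nonneg_right (hma i z hz) (abs_nonneg _)
  have hS0 : 0 < S := by
    obtain ⟨i, hi⟩ := Function.ne_iff.1 hxy
    exact Finset.sum_pos' (fun j _ => abs_nonneg _)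
      ⟨i, Finset.mem_univ i, abs_pos.2 (sub_ne_zero.2 hi)⟩
  have hA0 : 0 < A := (mul_pos hm hS0).trans_le hmS
  have hlin : |∑ i, a i z * (x i - y i)| ≤ A := by
    refine (Finset.abs_sum_le_sum_abs _ _).trans_eq (Finset.sum_congr rfl fun i _ => ?_)
    rw [abs_mul, abs_of_pos (ha_pos i z hz)]
  have htS : t * m / 2 * S ≤ t * A / 2 := by nlinarith
  have htA : t * A ≤ A := mul_le_of_le_one_left hA0.le (by linarith)
  have hpq : |F x - F y| ≤ 2 * A := by
    have := abs_sub_abs_le_abs_sub (F x - F y) (∑ i, a i z * (x i - y i))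
    linarith
  have hw : |F x + F y - 2 * F v - A| ≤ t * A := by
    have h : F x + F y - 2 * F v - A = (F x - F v - ∑ i, a i z * (x i - v i)) +
        (F y - F v - ∑ i, a i z * (y i - v i)) := by rw [← hsumA]; ring
    rw [h]
    refine (abs_add_le _ _).trans ((add_le_add hxv hyv).trans ?_)
    rw [← mul_add, hsumS]
    nlinarith [mul_pos ht hA0]
  have hIoo : ∀ p : ℝ, |p - 1 / 2| ≤ t → p ∈ Set.Ioo (0 : ℝ) 1 := fun p hp =>
    ⟨by linarith [(abs_le.1 hp).1], by linarith [(abs_le.1 hp).2]⟩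
  exact ⟨hIoo _ hp, hIoo _ hq,
    (abs_one_sub_corr_div_sub_one_le ht ht8 hp hq hA0 hw hpq).trans htε⟩
end

section
/- There exists δ > 0 such that for all x, y in the neighborhood E(δ) = {x ∈ [0,1]^n : ∃ z ∈ D with ∑_{i=1}^n |x_i − z_i| ≤ δ} with x ≠ y, one has F(x), F(y) ∈ (0,1) and F(x ∧ y) − F(x)F(y) < √(F(x)(1 − F(x)) · F(y)(1 − F(y))); that is, the correlation r(x, y) = (F(x ∧ y) − F(x)F(y)) / √(F(x)(1 − F(x)) F(y)(1 − F(y))) satisfies r(x, y) < 1 whenever x ≠ y in E(δ). -/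
open Set Filter Topology

/-- A first-order expansion with positive coefficients makes the function
strictly increasing near the base point. -/
theorem eventually_lt_of_expansion {ι : Type*} [Fintype ι] [Nonempty ι] {F : (ι → ℝ) → ℝ}
    {s : Set (ι → ℝ)} {z c : ι → ℝ} (hc : ∀ i, 0 < c i)
    (hF : ∀ ε > (0 : ℝ), ∃ δ > (0 : ℝ), ∀ x ∈ s, ∀ y ∈ s,
      (∑ i, |x i - z i|) ≤ δ → (∑ i, |y i - z i|) ≤ δ →
        |F x - F y - ∑ i, c i * (x i - y i)| ≤ ε * ∑ i, |x i - y i|) :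
    ∀ᶠ p : (ι → ℝ) × (ι → ℝ) in 𝓝 (z, z), p.1 ∈ s → p.2 ∈ s → p.1 < p.2 → F p.1 < F p.2 := by
  obtain ⟨i₀, hi₀⟩ := Finite.exists_min c
  obtain ⟨δ, hδ, h⟩ := hF (c i₀ / 2) (half_pos (hc i₀))
  have h₁ : ∀ᶠ p : (ι → ℝ) × (ι → ℝ) in 𝓝 (z, z), (∑ i, |p.1 i - z i|) < δ :=
    (by fun_prop : Continuous fun p : (ι → ℝ) × (ι → ℝ) => ∑ i, |p.1 i - z i|).continuousAt
      |>.eventually_lt continuousAt_const (by simpa using hδ)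
  have h₂ : ∀ᶠ p : (ι → ℝ) × (ι → ℝ) in 𝓝 (z, z), (∑ i, |p.2 i - z i|) < δ :=
    (by fun_prop : Continuous fun p : (ι → ℝ) × (ι → ℝ) => ∑ i, |p.2 i - z i|).continuousAt
      |>.eventually_lt continuousAt_const (by simpa using hδ)
  filter_upwards [h₁, h₂] with p hp₁ hp₂ hs₁ hs₂ hlt
  have key := (abs_le.1 (h p.2 hs₂ p.1 hs₁ hp₂.le hp₁.le)).1
  obtain ⟨hle, j, hj⟩ := Pi.lt_def.1 hlt
  have habs : ∑ i, |p.2 i - p.1 i| = ∑ i, (p.2 i - p.1 i) :=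
    Finset.sum_congr rfl fun i _ => abs_of_nonneg (sub_nonneg.2 (hle i))
  have hpos : 0 < ∑ i, (p.2 i - p.1 i) :=
    Finset.sum_pos' (fun i _ => sub_nonneg.2 (hle i)) ⟨j, Finset.mem_univ j, sub_pos.2 hj⟩
  have hlow : c i₀ * ∑ i, (p.2 i - p.1 i) ≤ ∑ i, c i * (p.2 i - p.1 i) := by
    rw [Finset.mul_sum]
    exact Finset.sum_le_sum fun i _ => mul_le_mul_of_nonneg_right (hi₀ i) (sub_nonneg.2 (hle i))
  rw [habs] at key
  nlinarith [mul_pos (hc i₀) hpos]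

/-- If `F` is strictly increasing near each point of its level set `{F = v}` in a convex set, then
`F < v` strictly below that level set. -/
theorem lt_level_of_lt {ι : Type*} [Fintype ι] {F : (ι → ℝ) → ℝ} {s : Set (ι → ℝ)} {v : ℝ}
    (hs : Convex ℝ s) (hF : ContinuousOn F s)
    (hmono : ∀ z ∈ s, F z = v →
      ∀ᶠ p : (ι → ℝ) × (ι → ℝ) in 𝓝 (z, z), p.1 ∈ s → p.2 ∈ s → p.1 < p.2 → F p.1 < F p.2)
    {m z : ι → ℝ} (hm : m ∈ s) (hz : z ∈ s) (hFz : F z = v) (hmz : m < z) : F m < v := by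
  by_contra! hFm
  set g : ℝ → ι → ℝ := fun t => AffineMap.lineMap m z t with hg
  have hgc : Continuous g := AffineMap.lineMap_continuous
  have hgs : ∀ t ∈ Icc (0 : ℝ) 1, g t ∈ s := fun t ht => hs.lineMap_mem hm hz ht
  have hg0 : g 0 = m := AffineMap.lineMap_apply_zero _ _
  have hg1 : g 1 = z := AffineMap.lineMap_apply_one _ _
  have hgm : StrictMono g := by
    intro t u htu
    simp only [hg, AffineMap.lineMap_apply_module']
    have : t • (z - m) < u • (z - m) := smul_lt_smul_of_pos_right htu (sub_pos.2 hmz)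
    simpa using this
  have hfc : ContinuousOn (F ∘ g) (Icc 0 1) := hF.comp hgc.continuousOn hgs
  have hsub : Icc (0 : ℝ) 1 ⊆ {t | v ≤ F (g t)} := by
    refine IsClosed.Icc_subset_of_forall_mem_nhdsWithin ?_ (by simpa [hg0] using hFm) ?_
    · rw [inter_comm]
      exact hfc.preimage_isClosed_of_isClosed isClosed_Icc isClosed_Ici
    · rintro t ⟨ht, ht0, ht1⟩
      have hts := hgs t ⟨ht0, ht1.le⟩
      have hnear : ∀ᶠ u in 𝓝[>] t, u ∈ Icc (0 : ℝ) 1 := by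
        filter_upwards [Ioo_mem_nhdsGT ht1] with u hu
        exact ⟨ht0.trans hu.1.le, hu.2.le⟩
      rcases (show v ≤ F (g t) from ht).eq_or_lt with heq | hlt
      · have htend : Tendsto (fun u => (g t, g u)) (𝓝[>] t) (𝓝 (g t, g t)) :=
          ((by fun_prop : Continuous fun u => (g t, g u)).tendsto t).mono_left nhdsWithin_le_nhds
        filter_upwards [htend.eventually (hmono _ hts heq.symm), hnear, self_mem_nhdsWithin]
          with u hu hu' htu
        exact heq.le.trans (hu hts (hgs u hu') (hgm htu)).le
      · have hct : Tendsto (F ∘ g) (𝓝[>] t) (𝓝 (F (g t))) :=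
          (hfc t ⟨ht0, ht1.le⟩).mono_left (le_inf nhdsWithin_le_nhds (le_principal_iff.2 hnear))
        filter_upwards [hct.eventually_const_lt hlt] with u hu
        exact hu.le
  have htend : Tendsto (fun u => (g u, z)) (𝓝[<] 1) (𝓝 (z, z)) := by
    have : Tendsto (fun u => (g u, z)) (𝓝 1) (𝓝 (g 1, z)) :=
      (by fun_prop : Continuous fun u => (g u, z)).tendsto 1
    rw [hg1] at this
    exact this.mono_left nhdsWithin_le_nhds
  obtain ⟨u, hu, hu0, hu1⟩ := ((htend.eventually (hmono z hz hFz)).and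
    (Ioo_mem_nhdsLT (zero_lt_one' ℝ))).exists
  have hu' : u ∈ Icc (0 : ℝ) 1 := ⟨hu0.le, hu1.le⟩
  have hlt := hu (hgs u hu') hz (hg1 ▸ hgm hu1)
  have hge : v ≤ F (g u) := hsub hu'
  linarith

/-- The correlation of two distinct events with probabilities `s`, `t` and intersection of
probability `p` is less than one. -/
theorem sub_mul_lt_sqrt {p s t : ℝ} (hs : s ∈ Ioo (0 : ℝ) 1) (ht : t ∈ Ioo (0 : ℝ) 1)
    (hps : p ≤ s) (hpt : p ≤ t) (hne : p < s ∨ p < t) :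
    p - s * t < √(s * (1 - s) * (t * (1 - t))) := by
  wlog hst : s ≤ t generalizing s t
  · have := this ht hs hpt hps hne.symm (le_of_not_ge hst)
    rwa [mul_comm t s, mul_comm (t * (1 - t))] at this
  obtain ⟨hs0, hs1⟩ := hs
  obtain ⟨ht0, ht1⟩ := ht
  have ha : 0 < s * (1 - t) := mul_pos hs0 (by linarith)
  have hle : s * (1 - t) ≤ √(s * (1 - s) * (t * (1 - t))) := by
    apply Real.le_sqrt_of_sq_le
    nlinarith [mul_le_mul_of_nonneg_left (show s * (1 - t) ≤ t * (1 - s) by nlinarith) ha.le]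
  rcases hps.lt_or_eq with h | h
  · nlinarith
  · have hlt : s < t := by rcases hne with h' | h' <;> linarith
    have : s * (1 - t) < √(s * (1 - s) * (t * (1 - t))) := by
      apply Real.lt_sqrt_of_sq_lt
      nlinarith [mul_lt_mul_of_pos_left (show s * (1 - t) < t * (1 - s) by nlinarith) ha]
    nlinarith

/-- Under condition (FEXM), there exists `δ > 0` such that for all
distinct `x, y` in `E(δ) = {x ∈ [0,1]^n : ∃ z ∈ D, ∑ |x_i - z_i| ≤ δ}` one has
`F(x), F(y) ∈ (0,1)` and `F(x∧y) - F(x)F(y) < √(F(x)(1-F(x)) F(y)(1-F(y)))`,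
i.e. the correlation `r(x,y) < 1`. -/
theorem stmt_12 (n : ℕ) (hn : 2 ≤ n)
    (F : (Fin n → ℝ) → ℝ)
    (hFcont : ContinuousOn F (Set.Icc (0 : Fin n → ℝ) 1))
    (D : Set (Fin n → ℝ))
    (hD : D = {x ∈ Set.Icc (0 : Fin n → ℝ) 1 | F x = 1 / 2})
    (hDne : D.Nonempty)
    (a : Fin n → (Fin n → ℝ) → ℝ)
    (ha_cont : ∀ i, ContinuousOn (a i) D)
    (ha_pos : ∀ i, ∀ z ∈ D, 0 < a i z)
    (hFEXM : ∀ ε > (0 : ℝ), ∃ δ > (0 : ℝ), ∀ z ∈ D,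
      ∀ x ∈ Set.Icc (0 : Fin n → ℝ) 1, ∀ y ∈ Set.Icc (0 : Fin n → ℝ) 1,
        (∑ i, |x i - z i|) ≤ δ → (∑ i, |y i - z i|) ≤ δ →
        |F x - F y - ∑ i, a i z * (x i - y i)| ≤ ε * ∑ i, |x i - y i|) :
    ∃ δ > (0 : ℝ), ∀ x y : Fin n → ℝ,
      x ∈ {w ∈ Set.Icc (0 : Fin n → ℝ) 1 | ∃ z ∈ D, (∑ i, |w i - z i|) ≤ δ} →
      y ∈ {w ∈ Set.Icc (0 : Fin n → ℝ) 1 | ∃ z ∈ D, (∑ i, |w i - z i|) ≤ δ} →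
      x ≠ y →
      F x ∈ Set.Ioo (0 : ℝ) 1 ∧ F y ∈ Set.Ioo (0 : ℝ) 1 ∧
      F (fun i => min (x i) (y i)) - F x * F y <
        Real.sqrt (F x * (1 - F x) * (F y * (1 - F y))) := by
  have : Nonempty (Fin n) := ⟨⟨0, by omega⟩⟩
  set I : Set (Fin n → ℝ) := Icc 0 1 with hI
  have hDI : ∀ z ∈ D, z ∈ I ∧ F z = 1 / 2 := fun z hz => by rw [hD] at hz; exact hz
  have hDc : IsCompact D := by
    refine isCompact_Icc.of_isClosed_subset ?_ fun z hz => (hDI z hz).1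
    rw [hD]
    exact hFcont.preimage_isClosed_of_isClosed isClosed_Icc isClosed_singleton
  have hmono : ∀ z ∈ I, F z = 1 / 2 → ∀ᶠ p : (Fin n → ℝ) × (Fin n → ℝ) in 𝓝 (z, z),
      p.1 ∈ I → p.2 ∈ I → p.1 < p.2 → F p.1 < F p.2 := by
    intro z hz hFz
    have hzD : z ∈ D := by rw [hD]; exact ⟨hz, hFz⟩
    refine eventually_lt_of_expansion (c := fun i => a i z) (fun i => ha_pos i z hzD) fun ε hε => ?_
    obtain ⟨δ, hδ, h⟩ := hFEXM ε hε
    exact ⟨δ, hδ, h z hzD⟩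
  have hinf : ∀ x ∈ I, ∀ y ∈ I, x ⊓ y ∈ I := fun x hx y hy =>
    ⟨le_inf hx.1 hy.1, inf_le_left.trans hx.2⟩
  have hcinf : Continuous fun p : (Fin n → ℝ) × (Fin n → ℝ) => p.1 ⊓ p.2 :=
    continuous_pi fun i => (by fun_prop : Continuous fun p : (Fin n → ℝ) × (Fin n → ℝ) =>
      min (p.1 i) (p.2 i))
  let U : Set ((Fin n → ℝ) × (Fin n → ℝ)) := {q | ∀ᶠ p in 𝓝 q, p ∈ I ×ˢ I → p.1 ≠ p.2 →
    F p.1 ∈ Ioo (0 : ℝ) 1 ∧ F p.2 ∈ Ioo (0 : ℝ) 1 ∧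
      F (p.1 ⊓ p.2) - F p.1 * F p.2 < √(F p.1 * (1 - F p.1) * (F p.2 * (1 - F p.2)))}
  have hU : IsOpen U := isOpen_setOfPred_eventually_nhds
  have hDU : D ×ˢ D ⊆ U := by
    rintro ⟨z, w⟩ ⟨hz, hw⟩
    obtain ⟨hzI, hFz⟩ := hDI z hz
    obtain ⟨hwI, hFw⟩ := hDI w hw
    refine (eventually_nhdsWithin_iff (s := I ×ˢ I)).1 ?_
    have hI₁ : ContinuousWithinAt (fun p : (Fin n → ℝ) × (Fin n → ℝ) => F p.1) (I ×ˢ I) (z, w) :=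
      (hFcont z hzI).comp continuousWithinAt_fst fun p hp => hp.1
    have hI₂ : ContinuousWithinAt (fun p : (Fin n → ℝ) × (Fin n → ℝ) => F p.2) (I ×ˢ I) (z, w) :=
      (hFcont w hwI).comp continuousWithinAt_snd fun p hp => hp.2
    have hmin : ContinuousWithinAt (fun p : (Fin n → ℝ) × (Fin n → ℝ) => F (p.1 ⊓ p.2))
        (I ×ˢ I) (z, w) :=
      ContinuousWithinAt.comp (f := fun p : (Fin n → ℝ) × (Fin n → ℝ) => p.1 ⊓ p.2)
        (hFcont (z ⊓ w) (hinf z hzI w hwI)) hcinf.continuousWithinAt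
        fun p hp => hinf p.1 hp.1 p.2 hp.2
    have hhalf : (1 / 2 : ℝ) ∈ Ioo (0 : ℝ) 1 := by norm_num
    have hev₁ := hI₁.eventually_mem (isOpen_Ioo.mem_nhds (hFz ▸ hhalf : F z ∈ Ioo (0 : ℝ) 1))
    have hev₂ := hI₂.eventually_mem (isOpen_Ioo.mem_nhds (hFw ▸ hhalf : F w ∈ Ioo (0 : ℝ) 1))
    by_cases hzw : z = w
    · subst hzw
      have ht₁ : Tendsto (fun p : (Fin n → ℝ) × (Fin n → ℝ) => (p.1 ⊓ p.2, p.1))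
          (𝓝 (z, z)) (𝓝 (z, z)) := by
        simpa using (hcinf.prodMk continuous_fst).tendsto (z, z)
      have ht₂ : Tendsto (fun p : (Fin n → ℝ) × (Fin n → ℝ) => (p.1 ⊓ p.2, p.2))
          (𝓝 (z, z)) (𝓝 (z, z)) := by
        simpa using (hcinf.prodMk continuous_snd).tendsto (z, z)
      filter_upwards [hev₁, hev₂, self_mem_nhdsWithin,
        nhdsWithin_le_nhds (ht₁.eventually (hmono z hzI hFz)),
        nhdsWithin_le_nhds (ht₂.eventually (hmono z hzI hFz))] with p h₁ h₂ hp hm₁ hm₂ hne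
      have hpI := hinf p.1 hp.1 p.2 hp.2
      refine ⟨h₁, h₂, sub_mul_lt_sqrt h₁ h₂ ?_ ?_ ?_⟩
      · rcases (inf_le_left : p.1 ⊓ p.2 ≤ p.1).eq_or_lt with h | h
        · rw [h]
        · exact (hm₁ hpI hp.1 h).le
      · rcases (inf_le_right : p.1 ⊓ p.2 ≤ p.2).eq_or_lt with h | h
        · rw [h]
        · exact (hm₂ hpI hp.2 h).le
      · rcases inf_lt_left_or_right hne with h | h
        · exact Or.inl (hm₁ hpI hp.1 h)
        · exact Or.inr (hm₂ hpI hp.2 h)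
    · have hlt : F (z ⊓ w) < 1 / 2 := by
        rcases inf_lt_left_or_right hzw with h | h
        · exact lt_level_of_lt (convex_Icc 0 1) hFcont hmono (hinf z hzI w hwI) hzI hFz h
        · exact lt_level_of_lt (convex_Icc 0 1) hFcont hmono (hinf z hzI w hwI) hwI hFw h
      have hsqrt : √(F z * (1 - F z) * (F w * (1 - F w))) = 1 / 4 := by
        rw [hFz, hFw, Real.sqrt_eq_iff_mul_self_eq] <;> norm_num
      have hev := (hmin.sub (hI₁.mul hI₂)).tendsto.eventually_lt
        ((hI₁.mul (continuousWithinAt_const.sub hI₁)).mul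
          (hI₂.mul (continuousWithinAt_const.sub hI₂))).sqrt.tendsto
        (show F (z ⊓ w) - F z * F w < √(F z * (1 - F z) * (F w * (1 - F w))) by
          rw [hsqrt, hFz, hFw]; linarith)
      filter_upwards [hev₁, hev₂, hev] with p h₁ h₂ h _
      exact ⟨h₁, h₂, h⟩
  obtain ⟨δ, hδ, hsub⟩ := (hDc.prod hDc).exists_cthickening_subset_open hU hDU
  refine ⟨δ, hδ, ?_⟩
  rintro x y ⟨hx, z, hz, hxz⟩ ⟨hy, w, hw, hyw⟩ hxy
  have hdist : ∀ u v : Fin n → ℝ, (∑ i, |u i - v i|) ≤ δ → dist u v ≤ δ := fun u v h =>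
    (dist_pi_le_iff hδ.le).2 fun i => (Finset.single_le_sum (f := fun i => |u i - v i|)
      (fun i _ => abs_nonneg _) (Finset.mem_univ i)).trans h
  have hmem : (x, y) ∈ U := hsub <| Metric.mem_cthickening_of_dist_le (x, y) (z, w) δ _ ⟨hz, hw⟩
    (max_le (hdist x z hxz) (hdist y w hyw))
  exact hmem.self_of_nhds ⟨hx, hy⟩ hxy
end
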